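/- arXiv:2308.04860 — 3 statements merged into one kernel-verified Lean document; each statement's English description precedes it below -/
import Mathlib

section
/- Let n agents have additive valuations over a finite set M of m > n items, and suppose the agents agree on the set of top n items: there exists a set T ⊆ M with |T| = n such that for every agent i, every g ∈ T and every h ∈ M \ T, v_i({g}) ≥ v_i({h}). Then there exists a complete allocation of M that is 2/3-EFX. -/
namespace EFX

open Finset

variable {V ι : Type*}

/-- The value agent `k` assigns to the bundle held in the state `s`, which consists of a labelled
family of bundles `s.2` and an assignment `s.1` of bundle labels to agents. -/
noncomputable def heldValue (w : V → ι → ℝ) (s : Equiv.Perm V × (V → Finset ι)) (k : V) : ℝ :=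
  ∑ x ∈ s.2 (s.1 k), w k x

/-- Agent `k` envies agent `j` in the state `s`. -/
def Envies (w : V → ι → ℝ) (s : Equiv.Perm V × (V → Finset ι)) (k j : V) : Prop :=
  heldValue w s k < ∑ x ∈ s.2 (s.1 j), w k x

/-- A relation on a finite type either admits a nontrivial rotation along its edges, or it has a
source `j` from which `i` is reachable by a path, encoded by a permutation closing that path. -/
theorem exists_rotation_or_source [Fintype V] (E : V → V → Prop) (i : V) :
    (∃ τ : Equiv.Perm V, (∀ k, τ k = k ∨ E k (τ k)) ∧ ∃ k, E k (τ k)) ∨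
    ∃ j, ∃ τ : Equiv.Perm V, (∀ k, ¬ E k j) ∧ τ i = j ∧ ∀ k, k ≠ i → τ k = k ∨ E k (τ k) := by
  classical
  have hf : ∀ k, ∃ p, E p k ∨ ((∀ q, ¬ E q k) ∧ p = i) := by
    intro k
    by_cases h : ∃ p, E p k
    · exact h.imp fun p hp => Or.inl hp
    · exact ⟨i, Or.inr ⟨not_exists.mp h, rfl⟩⟩
  choose f hf using hf
  have hbij := Function.bijOn_periodicPts f
  let e : Equiv.Perm (Function.periodicPts f) := hbij.equiv f
  have he : ∀ x, ((e x : Function.periodicPts f) : V) = f x := fun x => rfl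
  let τ : Equiv.Perm V := Equiv.Perm.ofSubtype e⁻¹
  have hτ_out : ∀ k, k ∉ Function.periodicPts f → τ k = k := fun k hk =>
    Equiv.Perm.ofSubtype_apply_of_not_mem _ hk
  have hτ_f : ∀ p, p ∈ Function.periodicPts f → τ (f p) = p := by
    intro p hp
    have h : τ ((e ⟨p, hp⟩ : Function.periodicPts f) : V) =
        (e⁻¹ (e ⟨p, hp⟩) : Function.periodicPts f) :=
      Equiv.Perm.ofSubtype_apply_coe _ _
    rw [he] at h
    simpa using h
  have hsurj : ∀ k, k ∈ Function.periodicPts f → ∃ p ∈ Function.periodicPts f, f p = k :=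
    fun k hk => hbij.surjOn hk
  by_cases hs : ∃ j ∈ Function.periodicPts f, ∀ q, ¬ E q j
  · obtain ⟨j, hj, hjs⟩ := hs
    have hfj : f j = i := ((hf j).resolve_left (hjs _)).2
    refine Or.inr ⟨j, τ, hjs, hfj ▸ hτ_f j hj, fun k hk => ?_⟩
    by_cases hkp : k ∈ Function.periodicPts f
    · obtain ⟨p, hp, rfl⟩ := hsurj k hkp
      rw [hτ_f p hp]
      exact Or.inr ((hf p).resolve_right fun h => hk h.2)
    · exact Or.inl (hτ_out k hkp)
  · push Not at hs
    have hE : ∀ p ∈ Function.periodicPts f, E (f p) p := by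
      intro p hp
      obtain ⟨q, hq⟩ := hs p hp
      exact (hf p).resolve_right fun h => h.1 q hq
    refine Or.inl ⟨τ, fun k => ?_, ?_⟩
    · by_cases hkp : k ∈ Function.periodicPts f
      · obtain ⟨p, hp, rfl⟩ := hsurj k hkp
        rw [hτ_f p hp]
        exact Or.inr (hE p hp)
      · exact Or.inl (hτ_out k hkp)
    · obtain ⟨a, b, hab, h⟩ : ∃ a b, a ≠ b ∧ f^[a] i = f^[b] i := by
        simpa [Function.Injective, and_comm] using
          not_injective_infinite_finite (fun a : ℕ => f^[a] i)
      obtain ⟨p, hp⟩ : ∃ p, p ∈ Function.periodicPts f := by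
        wlog hlt : a < b generalizing a b
        · exact this b a hab.symm h.symm (lt_of_le_of_ne (not_lt.mp hlt) hab.symm)
        refine ⟨f^[a] i, Function.mk_mem_periodicPts (Nat.sub_pos_of_lt hlt) ?_⟩
        rw [Function.IsPeriodicPt, Function.IsFixedPt, ← Function.iterate_add_apply,
          Nat.sub_add_cancel hlt.le, h]
      exact ⟨f p, (hτ_f p hp).symm ▸ hE p hp⟩

/-- Any nonempty family of states over a finite item set has a member that is Pareto maximal
with ties broken by the number of allocated items. -/
theorem exists_pareto_max [Fintype V] [DecidableEq V] (M : Finset ι) (w : V → ι → ℝ)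
    (P : Equiv.Perm V × (V → Finset ι) → Prop) (hPM : ∀ s, P s → ∀ b, s.2 b ⊆ M)
    (hne : ∃ s, P s) :
    ∃ s, P s ∧ ∀ s', P s' → (∀ k, heldValue w s k ≤ heldValue w s' k) →
      (∀ k, heldValue w s' k ≤ heldValue w s k) ∧ ∑ b, #(s'.2 b) ≤ ∑ b, #(s.2 b) := by
  have hfin : {s | P s}.Finite := by
    refine (Set.finite_univ.prod (Fintype.piFinset fun _ : V => M.powerset).finite_toSet).subset ?_
    intro s hs
    simpa using hPM s hs
  obtain ⟨s, hs, hmax⟩ := Set.exists_max_image {s | P s}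
    (fun s => toLex (∑ k, heldValue w s k, ∑ b, #(s.2 b))) hfin hne
  refine ⟨s, hs, fun s' hs' hle => ?_⟩
  have hlex := hmax s' hs'
  rw [Prod.Lex.toLex_le_toLex] at hlex
  have hsum : ∑ k, heldValue w s k ≤ ∑ k, heldValue w s' k := sum_le_sum fun k _ => hle k
  rcases hlex with h | ⟨h, hc⟩
  · exact absurd h (not_lt.mpr hsum)
  · refine ⟨fun k => ?_, hc⟩
    exact ((sum_eq_sum_iff_of_le fun k _ => hle k).mp h.symm k (mem_univ k)).ge

theorem heldValue_le_of_rotation {w : V → ι → ℝ} {s : Equiv.Perm V × (V → Finset ι)}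
    {τ : Equiv.Perm V} {k : V} (h : τ k = k ∨ Envies w s k (τ k)) :
    heldValue w s k ≤ heldValue w (s.1 * τ, s.2) k := by
  rcases h with h | h
  · simp [heldValue, h]
  · exact h.le

/-- In a state that is Pareto maximal within a family closed under improving rotations, every agent
is reached by an envy path from an unenvied agent `j`; `τ` closes this path. -/
theorem exists_source_of_pareto_max [Fintype V] {w : V → ι → ℝ}
    {P : Equiv.Perm V × (V → Finset ι) → Prop}
    {s : Equiv.Perm V × (V → Finset ι)}
    (hrot : ∀ τ : Equiv.Perm V, (∀ k, heldValue w s k ≤ heldValue w (s.1 * τ, s.2) k) →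
      P (s.1 * τ, s.2))
    (hmax : ∀ s', P s' → (∀ k, heldValue w s k ≤ heldValue w s' k) →
      (∀ k, heldValue w s' k ≤ heldValue w s k) ∧ ∑ b, #(s'.2 b) ≤ ∑ b, #(s.2 b)) (i : V) :
    ∃ j, ∃ τ : Equiv.Perm V, (∀ k, ¬ Envies w s k j) ∧ τ i = j ∧
      ∀ k, k ≠ i → τ k = k ∨ Envies w s k (τ k) := by
  refine (exists_rotation_or_source (Envies w s) i).resolve_left ?_
  rintro ⟨τ, hτ, k, hk⟩
  have hle := fun k => heldValue_le_of_rotation (hτ k)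
  exact absurd ((hmax _ (hrot τ hle) hle).1 k) (not_le.mpr hk)

/-- States in which bundle `b` consists of the item `e b` and at most one item outside `T`, and
nobody prefers the item `e b` of a two-item bundle to their own bundle. -/
def IsPairState [DecidableEq ι] (M T : Finset ι) (w : V → ι → ℝ) (e : V → ι)
    (s : Equiv.Perm V × (V → Finset ι)) : Prop :=
  (∀ b, s.2 b = {e b} ∨
    (∃ h ∈ M \ T, s.2 b = {e b, h}) ∧ ∀ k, w k (e b) ≤ heldValue w s k) ∧
  ∀ b c, b ≠ c → Disjoint (s.2 b) (s.2 c)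

theorem IsPairState.mono [DecidableEq ι] {M T : Finset ι} {w : V → ι → ℝ} {e : V → ι}
    {s : Equiv.Perm V × (V → Finset ι)} (hs : IsPairState M T w e s) {σ : Equiv.Perm V}
    (hle : ∀ k, heldValue w s k ≤ heldValue w (σ, s.2) k) : IsPairState M T w e (σ, s.2) :=
  ⟨fun b => (hs.1 b).imp_right fun h => ⟨h.1, fun k => (h.2 k).trans (hle k)⟩, hs.2⟩

theorem IsPairState.mem [DecidableEq ι] {M T : Finset ι} {w : V → ι → ℝ} {e : V → ι}
    {s : Equiv.Perm V × (V → Finset ι)} (hs : IsPairState M T w e s) (b : V) : e b ∈ s.2 b := by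
  rcases hs.1 b with h | ⟨⟨_, _, h⟩, _⟩ <;> simp [h]

theorem IsPairState.subset [DecidableEq ι] {M T : Finset ι} {w : V → ι → ℝ}
    {e : V → ι} (heM : ∀ b, e b ∈ M)
    {s : Equiv.Perm V × (V → Finset ι)} (hs : IsPairState M T w e s) (b : V) : s.2 b ⊆ M := by
  rcases hs.1 b with h | ⟨⟨g, hg, h⟩, _⟩
  · simpa [h] using heM b
  · rw [h, insert_subset_iff, singleton_subset_iff]
    exact ⟨heM b, (mem_sdiff.mp hg).1⟩

/-- Replacing the second item of a bundle by an unallocated one keeps a pair state when no agent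
loses. -/
theorem IsPairState.update [DecidableEq V] [DecidableEq ι] {M T : Finset ι}
    {w : V → ι → ℝ} {e : V → ι}
    {s : Equiv.Perm V × (V → Finset ι)} (hs : IsPairState M T w e s) {σ : Equiv.Perm V} {b : V}
    {g : ι} (hg : g ∈ M \ T) (hgs : ∀ c, g ∉ s.2 c) (hb : ∀ k, w k (e b) ≤ heldValue w s k)
    (hle : ∀ k, heldValue w s k ≤ heldValue w (σ, Function.update s.2 b {e b, g}) k) :
    IsPairState M T w e (σ, Function.update s.2 b {e b, g}) := by
  have hdisj : ∀ c, c ≠ b → Disjoint ({e b, g} : Finset ι) (s.2 c) := by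
    intro c hc
    rw [disjoint_insert_left, disjoint_singleton_left]
    exact ⟨disjoint_left.mp (hs.2 b c hc.symm) (hs.mem b), hgs c⟩
  refine ⟨fun c => ?_, fun c d hcd => ?_⟩
  · by_cases hc : c = b
    · subst hc
      exact Or.inr ⟨⟨g, hg, by simp⟩, fun k => (hb k).trans (hle k)⟩
    · simp only [Function.update_of_ne hc]
      exact (hs.1 c).imp_right fun h => ⟨h.1, fun k => (h.2 k).trans (hle k)⟩
  · by_cases hc : c = b
    · subst hc
      simpa [Function.update_of_ne hcd.symm] using hdisj d hcd.symm
    · by_cases hd : d = b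
      · subst hd
        simpa [Function.update_of_ne hc] using (hdisj c hc).symm
      · simpa [Function.update_of_ne hc, Function.update_of_ne hd] using hs.2 c d hcd

theorem heldValue_update [DecidableEq V] {w : V → ι → ℝ} {B : V → Finset ι}
    {σ : Equiv.Perm V} {b : V}
    {S : Finset ι} {k : V} :
    heldValue w (σ, Function.update B b S) k =
      if σ k = b then ∑ x ∈ S, w k x else ∑ x ∈ B (σ k), w k x := by
  by_cases h : σ k = b
  · subst h; simp [heldValue]
  · simp [heldValue, h]

/-- If all agents prefer the items `e b` to the remaining ones, some pair state gives every agent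
at least twice the value of each unallocated item. -/
theorem exists_pairState_two_mul_le [Fintype V] [DecidableEq V] [DecidableEq ι]
    (M T : Finset ι) (w : V → ι → ℝ)
    (hw : ∀ i, ∀ g ∈ M, 0 ≤ w i g) (e : V → ι) (he : Function.Injective e) (heM : ∀ b, e b ∈ M)
    (heT : ∀ g ∈ T, ∃ b, e b = g) (htop : ∀ i b, ∀ h ∈ M \ T, w i h ≤ w i (e b)) :
    ∃ s, IsPairState M T w e s ∧
      ∀ k, ∀ g ∈ M, (∀ b, g ∉ s.2 b) → 2 * w k g ≤ heldValue w s k := by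
  obtain ⟨s, hs, hmax⟩ := exists_pareto_max M w (IsPairState M T w e)
    (fun s hs => hs.subset heM)
    ⟨(1, fun b => {e b}), fun b => Or.inl rfl, fun b c hbc => by simpa using he.ne hbc⟩
  refine ⟨s, hs, fun i g hgM hgs => ?_⟩
  by_contra! hlt
  have hgT : g ∉ T := fun h => by
    obtain ⟨b, rfl⟩ := heT g h
    exact hgs b (hs.mem b)
  have hg : g ∈ M \ T := mem_sdiff.mpr ⟨hgM, hgT⟩
  have hne : ∀ b, e b ≠ g := fun b h => hgs b (h ▸ hs.mem b)
  have hpair : ∀ k b, ∑ x ∈ ({e b, g} : Finset ι), w k x = w k (e b) + w k g :=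
    fun k b => sum_pair (hne b)
  have hi : s.2 (s.1 i) = {e (s.1 i)} := by
    refine (hs.1 (s.1 i)).resolve_right ?_
    rintro ⟨⟨h, hh, hB⟩, hb⟩
    have hval : heldValue w s i ≤ w i (e (s.1 i)) + w i h := by
      rw [heldValue, hB]
      by_cases hEq : e (s.1 i) = h
      · have := hw i h (mem_sdiff.mp hh).1
        simp [hEq, this]
      · rw [sum_pair hEq]
    have h1 := htop i (s.1 i) g hg
    have hlt' : heldValue w s i < w i (e (s.1 i)) + w i g := by linarith
    have hle : ∀ k, heldValue w s k ≤
        heldValue w (s.1, Function.update s.2 (s.1 i) {e (s.1 i), g}) k := by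
      intro k
      rw [heldValue_update]
      split_ifs with hk
      · rw [s.1.injective hk, hpair]
        exact hlt'.le
      · exact le_rfl
    have := (hmax _ (hs.update hg hgs hb hle) hle).1 i
    rw [heldValue_update, if_pos rfl, hpair] at this
    linarith
  have hival : heldValue w s i = w i (e (s.1 i)) := by simp [heldValue, hi]
  obtain ⟨j, τ, hj, hτi, hτ⟩ := exists_source_of_pareto_max (fun τ => hs.mono) hmax i
  rcases hs.1 (s.1 j) with hB | ⟨⟨h, hh, hB⟩, hb⟩
  · have hb : ∀ k, w k (e (s.1 j)) ≤ heldValue w s k := by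
      intro k
      simpa [Envies, hB] using hj k
    have hle : ∀ k, heldValue w s k ≤
        heldValue w (s.1, Function.update s.2 (s.1 j) {e (s.1 j), g}) k := by
      intro k
      rw [heldValue_update]
      split_ifs with hk
      · rw [hpair, s.1.injective hk, heldValue, hB, sum_singleton]
        linarith [hw j g hgM]
      · exact le_rfl
    refine absurd (hmax _ (hs.update hg hgs hb hle) hle).2 (not_le.mpr ?_)
    refine sum_lt_sum (fun c _ => ?_) ⟨s.1 j, mem_univ _, ?_⟩
    · by_cases hc : c = s.1 j
      · subst hc
        simp [hB, card_pair (hne (s.1 j))]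
      · simp [hc]
    · simp [hB, card_pair (hne (s.1 j))]
  · have htop_j := htop i (s.1 j) g hg
    have hlt' : heldValue w s i < w i (e (s.1 j)) + w i g := by linarith
    have hle : ∀ k, heldValue w s k ≤
        heldValue w (s.1 * τ, Function.update s.2 (s.1 j) {e (s.1 j), g}) k := by
      intro k
      rw [heldValue_update]
      split_ifs with hk
      · have hki : k = i := τ.injective (hτi ▸ s.1.injective hk)
        rw [hki, hpair]
        exact hlt'.le
      · have hki : k ≠ i := fun h => hk (by rw [h, Equiv.Perm.mul_apply, hτi])
        exact heldValue_le_of_rotation (hτ k hki)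
    have := (hmax _ (hs.update hg hgs hb hle) hle).1 i
    rw [heldValue_update, if_pos (by rw [Equiv.Perm.mul_apply, hτi]), hpair] at this
    linarith

/-- Partial 2/3-EFX states in which every agent holds at least twice the value of each
unallocated item. -/
def IsExtendable [DecidableEq ι] (M : Finset ι) (w : V → ι → ℝ)
    (s : Equiv.Perm V × (V → Finset ι)) : Prop :=
  (∀ b, s.2 b ⊆ M) ∧ (∀ b c, b ≠ c → Disjoint (s.2 b) (s.2 c)) ∧
  (∀ k b, ∀ g ∈ s.2 b, (2 / 3 : ℝ) * ∑ x ∈ (s.2 b).erase g, w k x ≤ heldValue w s k) ∧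
  ∀ k, ∀ g ∈ M, (∀ b, g ∉ s.2 b) → 2 * w k g ≤ heldValue w s k

theorem IsExtendable.mono [DecidableEq ι] {M : Finset ι} {w : V → ι → ℝ}
    {s : Equiv.Perm V × (V → Finset ι)}
    (hs : IsExtendable M w s) {σ : Equiv.Perm V}
    (hle : ∀ k, heldValue w s k ≤ heldValue w (σ, s.2) k) : IsExtendable M w (σ, s.2) :=
  ⟨hs.1, hs.2.1, fun k b g hg => (hs.2.2.1 k b g hg).trans (hle k),
    fun k g hg hgs => (hs.2.2.2 k g hg hgs).trans (hle k)⟩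

theorem IsPairState.isExtendable [DecidableEq ι] {M T : Finset ι} {w : V → ι → ℝ} {e : V → ι}
    {s : Equiv.Perm V × (V → Finset ι)} (hs : IsPairState M T w e s)
    (hw : ∀ i, ∀ g ∈ M, 0 ≤ w i g) (heM : ∀ b, e b ∈ M)
    (htop : ∀ i b, ∀ h ∈ M \ T, w i h ≤ w i (e b))
    (hfree : ∀ k, ∀ g ∈ M, (∀ b, g ∉ s.2 b) → 2 * w k g ≤ heldValue w s k) :
    IsExtendable M w s := by
  have hsub := hs.subset heM
  have hmem : ∀ k, w k (e (s.1 k)) ≤ heldValue w s k := fun k =>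
    single_le_sum (f := w k) (fun x hx => hw k x (hsub _ hx)) (hs.mem (s.1 k))
  have hpos : ∀ k, 0 ≤ heldValue w s k := fun k => (hw k _ (heM _)).trans (hmem k)
  refine ⟨hsub, hs.2, fun k b g hg => ?_, hfree⟩
  suffices h : ∑ x ∈ (s.2 b).erase g, w k x ≤ heldValue w s k by linarith [hpos k]
  rcases hs.1 b with hB | ⟨⟨h, hh, hB⟩, hb⟩
  · rw [hB, mem_singleton] at hg
    simpa [hB, hg] using hpos k
  · have hne_or : (s.2 b).erase g ⊆ {e b} ∨ (s.2 b).erase g ⊆ {h} := by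
      rw [hB, mem_insert, mem_singleton] at hg
      rw [hB]
      rcases hg with rfl | rfl
      · right; intro x; simp +contextual
      · left; intro x; simp +contextual
    rcases hne_or with hsub' | hsub'
    · refine (sum_le_sum_of_subset_of_nonneg hsub' fun x hx _ => ?_).trans ?_
      · rw [mem_singleton.mp hx]; exact hw k _ (heM b)
      · simpa using hb k
    · refine (sum_le_sum_of_subset_of_nonneg hsub' fun x hx _ => ?_).trans ?_
      · rw [mem_singleton.mp hx]; exact hw k _ (mem_sdiff.mp hh).1
      · simpa using (htop k (s.1 k) h hh).trans (hmem k)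

/-- Giving an unallocated item to an unenvied agent keeps a state extendable. -/
theorem IsExtendable.insert_item [DecidableEq V] [DecidableEq ι] {M : Finset ι} {w : V → ι → ℝ}
    {s : Equiv.Perm V × (V → Finset ι)} (hs : IsExtendable M w s)
    (hw : ∀ i, ∀ g ∈ M, 0 ≤ w i g) {j : V} (hj : ∀ k, ¬ Envies w s k j) {g : ι} (hgM : g ∈ M)
    (hgs : ∀ b, g ∉ s.2 b)
    (hle : ∀ k, heldValue w s k ≤
      heldValue w (s.1, Function.update s.2 (s.1 j) (insert g (s.2 (s.1 j)))) k) :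
    IsExtendable M w (s.1, Function.update s.2 (s.1 j) (insert g (s.2 (s.1 j)))) := by
  obtain ⟨hsub, hdisj, hefx, hfree⟩ := hs
  have hdisj' : ∀ c, c ≠ s.1 j → Disjoint (insert g (s.2 (s.1 j))) (s.2 c) := fun c hc =>
    disjoint_insert_left.mpr ⟨hgs c, hdisj _ _ hc.symm⟩
  refine ⟨fun b => ?_, fun c d hcd => ?_, fun k b x hx => ?_, fun k x hx hxs => ?_⟩
  · by_cases hb : b = s.1 j
    · subst hb
      simpa [insert_subset_iff] using ⟨hgM, hsub _⟩
    · simpa [hb] using hsub b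
  · by_cases hc : c = s.1 j
    · subst hc
      simpa [Function.update_of_ne hcd.symm] using hdisj' d hcd.symm
    · by_cases hd : d = s.1 j
      · subst hd
        simpa [Function.update_of_ne hc] using (hdisj' c hc).symm
      · simpa [Function.update_of_ne hc, Function.update_of_ne hd] using hdisj c d hcd
  · refine le_trans ?_ (hle k)
    by_cases hb : b = s.1 j
    · subst hb
      simp only [Function.update_self] at hx ⊢
      have h1 : ∑ y ∈ (insert g (s.2 (s.1 j))).erase x, w k y ≤
          ∑ y ∈ insert g (s.2 (s.1 j)), w k y :=
        sum_le_sum_of_subset_of_nonneg (erase_subset _ _) fun y hy _ =>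
          hw k y (insert_subset hgM (hsub _) hy)
      rw [sum_insert (hgs _)] at h1
      have h2 := not_lt.mp (hj k)
      have h3 := hfree k g hgM hgs
      linarith
    · simp only [Function.update_of_ne hb] at hx ⊢
      exact hefx k b x hx
  · refine (hfree k x hx fun b hxb => ?_).trans (hle k)
    by_cases hb : b = s.1 j
    · exact hxs b (by subst hb; simp [hxb])
    · exact hxs b (by simpa [hb] using hxb)

/-- An extendable state yields one in which all items are allocated. -/
theorem IsExtendable.exists_complete [Fintype V] [DecidableEq V] [DecidableEq ι] [Nonempty V]
    {M : Finset ι} {w : V → ι → ℝ}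
    {s₀ : Equiv.Perm V × (V → Finset ι)} (hs₀ : IsExtendable M w s₀)
    (hw : ∀ i, ∀ g ∈ M, 0 ≤ w i g) :
    ∃ s, IsExtendable M w s ∧ ∀ g ∈ M, ∃ b, g ∈ s.2 b := by
  obtain ⟨s, hs, hmax⟩ := exists_pareto_max M w (IsExtendable M w) (fun s hs => hs.1) ⟨s₀, hs₀⟩
  refine ⟨s, hs, fun g hgM => ?_⟩
  by_contra! hgs
  obtain ⟨j, -, hj, -⟩ :=
    exists_source_of_pareto_max (fun τ => hs.mono) hmax (Classical.arbitrary V)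
  have hle : ∀ k, heldValue w s k ≤
      heldValue w (s.1, Function.update s.2 (s.1 j) (insert g (s.2 (s.1 j)))) k := by
    intro k
    rw [heldValue_update]
    split_ifs with hk
    · rw [sum_insert (hgs _), heldValue, hk]
      linarith [hw k g hgM]
    · exact le_rfl
  refine absurd (hmax _ (hs.insert_item hw hj hgM hgs hle) hle).2 (not_le.mpr ?_)
  refine sum_lt_sum (fun c _ => ?_) ⟨s.1 j, mem_univ _, ?_⟩
  · by_cases hc : c = s.1 j
    · subst hc
      simp [card_insert_of_notMem (hgs _)]
    · simp [hc]
  · simp [card_insert_of_notMem (hgs _)]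

end EFX


/-- If `m > n` agents with additive valuations agree on the set `T` of the top `n` items,
then a 2/3-EFX complete allocation exists. -/
theorem twothirds_efx_common_top_n {ι : Type*} [DecidableEq ι] (n : ℕ) (hn : 1 ≤ n)
    (M : Finset ι) (w : Fin n → ι → ℝ)
    (hw : ∀ i, ∀ g ∈ M, 0 ≤ w i g)
    (hm : n < M.card)
    (T : Finset ι) (hTM : T ⊆ M) (hTcard : T.card = n)
    (htop : ∀ i, ∀ g ∈ T, ∀ h ∈ M \ T, w i h ≤ w i g) :
    ∃ A : Fin n → Finset ι,
      (∀ i, A i ⊆ M) ∧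
      (∀ g ∈ M, ∃ i, g ∈ A i) ∧
      (∀ i j, i ≠ j → Disjoint (A i) (A j)) ∧
      (∀ i j, ∀ g ∈ A j,
        (2/3 : ℝ) * ∑ x ∈ (A j).erase g, w i x ≤ ∑ x ∈ A i, w i x) := by
  have : Nonempty (Fin n) := ⟨⟨0, hn⟩⟩
  let e : Fin n ≃ T := (T.equivFinOfCardEq hTcard).symm
  have heM : ∀ b, (e b : ι) ∈ M := fun b => hTM (e b).2
  have htop' : ∀ i b, ∀ h ∈ M \ T, w i h ≤ w i (e b) := fun i b => htop i _ (e b).2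
  obtain ⟨s₀, hs₀, hfree⟩ := EFX.exists_pairState_two_mul_le M T w hw (fun b => (e b : ι))
    (Subtype.val_injective.comp e.injective) heM
    (fun g hg => ⟨e.symm ⟨g, hg⟩, by simp⟩) htop'
  obtain ⟨s, ⟨hsub, hdisj, hefx, -⟩, hall⟩ :=
    (hs₀.isExtendable hw heM htop' hfree).exists_complete hw
  refine ⟨fun i => s.2 (s.1 i), fun i => hsub _, fun g hg => ?_,
    fun i j hij => hdisj _ _ (s.1.injective.ne hij), fun i j g hg => hefx i _ g hg⟩
  obtain ⟨b, hb⟩ := hall g hg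
  exact ⟨s.1.symm b, by simpa using hb⟩
end

section
/- Let n agents have additive valuations over a finite set M of m > n items, and suppose there exists a set T ⊆ M with |T| = n such that for every agent i, every g ∈ T and every h ∈ M \ T, v_i({g}) ≥ v_i({h}). Then there exists a partial allocation S = (S_1,...,S_n) of M in which every bundle S_i is nonempty, every item of T is allocated, each agent receives at most two items, S is 2/3-EFX, and for every agent i and every item h ∈ M not allocated by S it holds that v_i(S_i) ≥ 2·v_i({h}). -/
section TopItemMatching

variable {N X : Type*}

/-- The value to agent `k` of the top item `σ k` together with the optional extra item `f k`. -/
def matchValue (W : N → N → ℝ) (U : N → X → ℝ) (σ : Equiv.Perm N) (f : N → Option X) (k : N) : ℝ :=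
  W k (σ k) + (f k).elim 0 (U k)

/-- A matching of top items with injectively assigned extra items is stable if nobody prefers the
top item of an agent holding an extra item to her own bundle. -/
def StableMatch (W : N → N → ℝ) (U : N → X → ℝ) (σ : Equiv.Perm N) (f : N → Option X) : Prop :=
  (∀ i j x, f i = some x → f j = some x → i = j) ∧
    ∀ i j, f j ≠ none → W i (σ j) ≤ matchValue W U σ f i

/-- If `i` holds no extra item in a stable match, the agents other than `i` can be rematched,
possibly dropping extra items, so that none of them loses or prefers the top item left to `i`. -/
lemma StableMatch.exists_rematch [Fintype N] [DecidableEq N] [Finite X]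
    {W : N → N → ℝ} {U : N → X → ℝ} {σ : Equiv.Perm N} {f : N → Option X}
    (hs : StableMatch W U σ f) {i : N} (hi : f i = none) :
    ∃ (τ : Equiv.Perm N) (e : N → Option X), e i = none ∧ (∀ j, e j = none ∨ e j = f j) ∧
      (∀ k, k ≠ i → matchValue W U σ f k ≤ matchValue W U τ e k) ∧
      (∀ k j, k ≠ i → e j ≠ none → W k (τ j) ≤ matchValue W U τ e k) ∧
      (∀ j, e j ≠ none → W i (τ j) ≤ W i (σ i)) ∧
      (∀ k, k ≠ i → W k (τ i) ≤ matchValue W U τ e k) := by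
  obtain ⟨⟨τ, e⟩, ⟨h1, h2, h3, h4, h5⟩, hmax⟩ := Set.exists_max_image
    {p : Equiv.Perm N × (N → Option X) | p.2 i = none ∧ (∀ j, p.2 j = none ∨ p.2 j = f j) ∧
      (∀ k, k ≠ i → matchValue W U σ f k ≤ matchValue W U p.1 p.2 k) ∧
      (∀ k j, k ≠ i → p.2 j ≠ none → W k (p.1 j) ≤ matchValue W U p.1 p.2 k) ∧
      (∀ j, p.2 j ≠ none → W i (p.1 j) ≤ W i (σ i))}
    (fun p => ∑ k ∈ Finset.univ.erase i, matchValue W U p.1 p.2 k) (Set.toFinite _)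
    ⟨(σ, f), hi, fun j => Or.inr rfl, fun k _ => le_rfl, fun k j _ hj => hs.2 k j hj,
      fun j hj => by simpa [matchValue, hi] using hs.2 i j hj⟩
  dsimp only at h1 h2 h3 h4 h5 hmax
  refine ⟨τ, e, h1, h2, h3, h4, h5, fun k hk => ?_⟩
  by_contra! hlt
  have hvk : matchValue W U (τ * Equiv.swap i k) (Function.update e k none) k = W k (τ i) := by
    simp [matchValue]
  have hvl : ∀ l, l ≠ i → l ≠ k →
      matchValue W U (τ * Equiv.swap i k) (Function.update e k none) l = matchValue W U τ e l := by
    intro l hli hlk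
    simp [matchValue, Equiv.swap_apply_of_ne_of_ne hli hlk, Function.update_of_ne hlk]
  have hle : ∀ l, l ≠ i → matchValue W U τ e l ≤
      matchValue W U (τ * Equiv.swap i k) (Function.update e k none) l := by
    intro l hli
    by_cases hlk : l = k
    · subst hlk; rw [hvk]; exact hlt.le
    · rw [hvl l hli hlk]
  have hextra : ∀ j, Function.update e k none j ≠ none →
      e j ≠ none ∧ (τ * Equiv.swap i k) j = τ j := by
    intro j hj
    have hjk : j ≠ k := by rintro rfl; simp at hj
    rw [Function.update_of_ne hjk] at hj
    have hji : j ≠ i := by rintro rfl; exact hj h1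
    exact ⟨hj, by simp [Equiv.swap_apply_of_ne_of_ne hji hjk]⟩
  refine absurd (hmax (τ * Equiv.swap i k, Function.update e k none)
    ⟨?_, fun j => ?_, fun l hl => (h3 l hl).trans (hle l hl), fun l j hl hj => ?_,
      fun j hj => ?_⟩) (not_le.2 ?_)
  · simp [Function.update_of_ne hk.symm, h1]
  · by_cases hjk : j = k
    · subst hjk; simp
    · simpa [Function.update_of_ne hjk] using h2 j
  · obtain ⟨hj, he⟩ := hextra j hj
    dsimp only
    rw [he]
    exact (h4 l j hl hj).trans (hle l hl)
  · obtain ⟨hj, he⟩ := hextra j hj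
    dsimp only
    rw [he]
    exact h5 j hj
  · refine Finset.sum_lt_sum (fun l hl => hle l (Finset.ne_of_mem_erase hl))
      ⟨k, by simp [hk], ?_⟩
    dsimp only
    rw [hvk]
    exact hlt

/-- If every top item is worth at least every extra item, some stable match gives every agent
at least twice the value of each unassigned extra item. -/
lemma exists_stableMatch_two_mul_le [Fintype N] [DecidableEq N] [Finite X]
    (W : N → N → ℝ) (U : N → X → ℝ) (hU : ∀ i x, 0 ≤ U i x) (hUW : ∀ i x t, U i x ≤ W i t) :
    ∃ (σ : Equiv.Perm N) (f : N → Option X), StableMatch W U σ f ∧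
      ∀ i x, (∀ j, f j ≠ some x) → 2 * U i x ≤ matchValue W U σ f i := by
  obtain ⟨⟨σ, f⟩, hs, hmax⟩ := Set.exists_max_image
    {p : Equiv.Perm N × (N → Option X) | StableMatch W U p.1 p.2}
    (fun p => ∑ k, matchValue W U p.1 p.2 k) (Set.toFinite _)
    ⟨(1, fun _ => none), by simp [StableMatch]⟩
  replace hs : StableMatch W U σ f := hs
  dsimp only at hmax
  refine ⟨σ, f, hs, fun i x hx => ?_⟩
  by_contra! hlt
  suffices hbetter : ∃ (τ : Equiv.Perm N) (e : N → Option X), StableMatch W U τ e ∧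
      (∀ k, k ≠ i → matchValue W U σ f k ≤ matchValue W U τ e k) ∧
      matchValue W U σ f i < matchValue W U τ e i by
    obtain ⟨τ, e, hτ, hle, hi⟩ := hbetter
    refine absurd (hmax (τ, e) hτ) (not_le.2 ?_)
    refine Finset.sum_lt_sum (fun k _ => ?_) ⟨i, Finset.mem_univ i, hi⟩
    by_cases hk : k = i
    · subst hk; exact hi.le
    · exact hle k hk
  obtain ⟨τ, e, hef, hle, hnoenvy, hiold, hfree, hival⟩ :
      ∃ (τ : Equiv.Perm N) (e : N → Option X), (∀ j, j ≠ i → e j = none ∨ e j = f j) ∧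
      (∀ k, k ≠ i → matchValue W U σ f k ≤ matchValue W U τ e k) ∧
      (∀ k j, k ≠ i → j ≠ i → e j ≠ none → W k (τ j) ≤ matchValue W U τ e k) ∧
      (∀ j, j ≠ i → e j ≠ none → W i (τ j) ≤ matchValue W U σ f i) ∧
      (∀ k, k ≠ i → W k (τ i) ≤ matchValue W U τ e k) ∧
      matchValue W U σ f i < W i (τ i) + U i x := by
    cases hi : f i with
    | none =>
      obtain ⟨τ, e, -, h2, h3, h4, h5, h6⟩ := hs.exists_rematch hi
      have hv : matchValue W U σ f i = W i (σ i) := by simp [matchValue, hi]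
      exact ⟨τ, e, fun j _ => h2 j, h3, fun k j hk _ hj => h4 k j hk hj,
        fun j _ hj => hv ▸ h5 j hj, h6, by linarith [hUW i x (τ i)]⟩
    | some y =>
      exact ⟨σ, f, fun j _ => Or.inr rfl, fun k _ => le_rfl, fun k j _ _ hj => hs.2 k j hj,
        fun j _ hj => hs.2 i j hj, fun k _ => hs.2 k i (by simp [hi]),
        by linarith [hUW i x (σ i)]⟩
  have hvi : matchValue W U τ (Function.update e i (some x)) i = W i (τ i) + U i x := by
    simp [matchValue]
  have hvk : ∀ k, k ≠ i →
      matchValue W U τ (Function.update e i (some x)) k = matchValue W U τ e k := by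
    intro k hk
    simp [matchValue, Function.update_of_ne hk]
  have hne : ∀ j, j ≠ i → e j ≠ some x := by
    intro j hj h
    rcases hef j hj with h' | h'
    · simp [h'] at h
    · exact hx j (h' ▸ h)
  refine ⟨τ, Function.update e i (some x), ⟨fun k j y hky hjy => ?_, fun k j hj => ?_⟩,
    fun k hk => by rw [hvk k hk]; exact hle k hk, by rw [hvi]; exact hival⟩
  · by_cases hk : k = i <;> by_cases hj : j = i
    · rw [hk, hj]
    · subst hk
      simp only [Function.update_self, Function.update_of_ne hj] at hky hjy
      exact absurd (hjy.trans hky.symm) (hne j hj)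
    · subst hj
      simp only [Function.update_self, Function.update_of_ne hk] at hky hjy
      exact absurd (hky.trans hjy.symm) (hne k hk)
    · rw [Function.update_of_ne hk] at hky
      rw [Function.update_of_ne hj] at hjy
      refine hs.1 k j y ?_ ?_
      · rcases hef k hk with h | h
        · simp [h] at hky
        · rw [← h, hky]
      · rcases hef j hj with h | h
        · simp [h] at hjy
        · rw [← h, hjy]
  · by_cases hj' : j = i
    · subst hj'
      by_cases hk : k = j
      · subst hk
        rw [hvi]
        linarith [hU k x]
      · rw [hvk k hk]
        exact hfree k hk
    · rw [Function.update_of_ne hj'] at hj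
      by_cases hk : k = i
      · subst hk
        rw [hvi]
        exact (hiold j hj' hj).trans hival.le
      · rw [hvk k hk]
        exact hnoenvy k j hk hj' hj

end TopItemMatching


/-- Under agreement on the set `T` of the top `n` items, there exists a partial allocation
`S` with nonempty bundles, allocating all of `T`, at most two items per agent, which is
2/3-EFX and in which every agent values her bundle at least twice any unallocated item. -/
theorem partial_allocation_common_top_n {ι : Type*} [DecidableEq ι] (n : ℕ) (hn : 1 ≤ n)
    (M : Finset ι) (w : Fin n → ι → ℝ)
    (hw : ∀ i, ∀ g ∈ M, 0 ≤ w i g)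
    (hm : n < M.card)
    (T : Finset ι) (hTM : T ⊆ M) (hTcard : T.card = n)
    (htop : ∀ i, ∀ g ∈ T, ∀ h ∈ M \ T, w i h ≤ w i g) :
    ∃ S : Fin n → Finset ι,
      (∀ i, S i ⊆ M) ∧
      (∀ i j, i ≠ j → Disjoint (S i) (S j)) ∧
      (∀ i, (S i).Nonempty) ∧
      (∀ g ∈ T, ∃ i, g ∈ S i) ∧
      (∀ i, (S i).card ≤ 2) ∧
      (∀ i j, ∀ g ∈ S j,
        (2/3 : ℝ) * ∑ x ∈ (S j).erase g, w i x ≤ ∑ x ∈ S i, w i x) ∧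
      (∀ i, ∀ h ∈ M, (∀ j, h ∉ S j) → 2 * w i h ≤ ∑ x ∈ S i, w i x) := by
  classical
  let e : Fin n ≃ T := (T.equivFinOfCardEq hTcard).symm
  obtain ⟨σ, f, ⟨hinj, henvy⟩, htwo⟩ := exists_stableMatch_two_mul_le
    (fun i t => w i (e t)) (fun i (x : {x // x ∈ M \ T}) => w i x)
    (fun i x => hw i x (Finset.mem_sdiff.1 x.2).1) (fun i x t => htop i _ (e t).2 _ x.2)
  let R : Fin n → Finset ι := fun i => (f i).elim ∅ fun x => {x.1}
  have hR : ∀ i y, y ∈ R i ↔ ∃ hy : y ∈ M \ T, f i = some ⟨y, hy⟩ := by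
    intro i y
    cases hf : f i with
    | none => simp [R, hf]
    | some x =>
      simp only [R, hf, Option.elim_some, Finset.mem_singleton, Option.some.injEq]
      exact ⟨fun h => ⟨h ▸ x.2, Subtype.ext h.symm⟩, fun ⟨_, h⟩ => by rw [h]⟩
  have hRT : ∀ i y, y ∈ R i → y ∈ M ∧ y ∉ T := by
    intro i y hy
    obtain ⟨hy, -⟩ := (hR i y).1 hy
    exact Finset.mem_sdiff.1 hy
  have heR : ∀ i j, (e (σ i) : ι) ∉ R j := fun i j h => (hRT j _ h).2 (e (σ i)).2
  have hRsum : ∀ i j, ∑ x ∈ R j, w i x = (f j).elim 0 fun x => w i x := by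
    intro i j
    cases hf : f j <;> simp [R, hf]
  have hSsum : ∀ i, ∑ x ∈ insert (e (σ i) : ι) (R i), w i x =
      matchValue (fun i t => w i (e t)) (fun i (x : {x // x ∈ M \ T}) => w i x) σ f i := by
    intro i
    rw [Finset.sum_insert (heR i i), hRsum, matchValue]
  have hRnonneg : ∀ i j, 0 ≤ ∑ x ∈ R j, w i x := fun i j =>
    Finset.sum_nonneg fun x hx => hw i x (hRT j x hx).1
  have hRle : ∀ i j, ∑ x ∈ R j, w i x ≤ w i (e (σ i)) := by
    intro i j
    rw [hRsum]
    cases hf : f j with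
    | none => exact hw i _ (hTM (e (σ i)).2)
    | some x => exact htop i _ (e (σ i)).2 _ x.2
  have hRcard : ∀ i, (R i).card ≤ 1 := by
    intro i
    cases hf : f i <;> simp [R, hf]
  refine ⟨fun i => insert (e (σ i) : ι) (R i), fun i => ?_, fun i j hij => ?_,
    fun i => Finset.insert_nonempty _ _, fun g hg => ?_, fun i => ?_, fun i j g hg => ?_,
    fun i h hh hfree => ?_⟩
  · exact Finset.insert_subset (hTM (e (σ i)).2) fun y hy => (hRT i y hy).1
  · rw [Finset.disjoint_left]
    intro y hyi hyj
    rcases Finset.mem_insert.1 hyi with rfl | hyi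
    · rcases Finset.mem_insert.1 hyj with h | h
      · exact hij (σ.injective (e.injective (Subtype.ext h)))
      · exact heR i j h
    · rcases Finset.mem_insert.1 hyj with rfl | hyj
      · exact heR j i hyi
      · obtain ⟨hy, hi⟩ := (hR i y).1 hyi
        obtain ⟨_, hj⟩ := (hR j y).1 hyj
        exact hij (hinj i j ⟨y, hy⟩ hi hj)
  · exact ⟨σ.symm (e.symm ⟨g, hg⟩), by simp⟩
  · exact (Finset.card_insert_le _ _).trans (Nat.succ_le_succ (hRcard i))
  · have hpos : 0 ≤ ∑ x ∈ insert (e (σ i) : ι) (R i), w i x := by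
      rw [Finset.sum_insert (heR i i)]
      exact add_nonneg (hw i _ (hTM (e (σ i)).2)) (hRnonneg i i)
    suffices hle : ∑ x ∈ (insert (e (σ j) : ι) (R j)).erase g, w i x ≤
        ∑ x ∈ insert (e (σ i) : ι) (R i), w i x by
      dsimp only
      linarith
    rcases Finset.mem_insert.1 hg with rfl | hg
    · rw [Finset.erase_insert (heR j j), Finset.sum_insert (heR i i)]
      linarith [hRle i j, hRnonneg i i]
    · have hRg : R j = {g} := Finset.eq_singleton_iff_unique_mem.2
        ⟨hg, fun y hy => Finset.card_le_one.1 (hRcard j) y hy g hg⟩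
      have hgne : g ≠ e (σ j) := by rintro rfl; exact heR j j hg
      obtain ⟨_, hfj⟩ := (hR j g).1 hg
      rw [hRg, Finset.erase_insert_of_ne hgne.symm, Finset.erase_singleton, insert_empty_eq,
        Finset.sum_singleton, hSsum]
      exact henvy i j (by simp [hfj])
  · dsimp only at hfree ⊢
    have hhT : h ∉ T := fun hT =>
      hfree (σ.symm (e.symm ⟨h, hT⟩)) (by simp)
    have hhX : h ∈ M \ T := Finset.mem_sdiff.2 ⟨hh, hhT⟩
    rw [hSsum]
    exact htwo i ⟨h, hhX⟩ fun j hj =>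
      hfree j (Finset.mem_insert_of_mem ((hR j h).2 ⟨hhX, hj⟩))
end

section
/- Let n ≥ 3 agents have monotone, nonnegative, cancelable valuations (with v_i(∅) = 0) over a finite set M of items, and suppose the agents have a common tiered ranking of size at most 3: there is an ordered partition M = M_1 ∪ M_2 ∪ ... ∪ M_s into pairwise disjoint tiers with |M_j| ≤ 3 for every j, such that for every agent i, all indices k < j, every g ∈ M_k and every h ∈ M_j, v_i({g}) ≥ v_i({h}). Then there exists a complete allocation of M that is EFX. -/
open Relation in
/-- Along a path from `c` to `k` in an acyclic relation one may shift every vertex to its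
successor and send `k` to `c`. -/
theorem exists_perm_shift {α : Type*} [DecidableEq α] {E : α → α → Prop} (wf : WellFounded E)
    {c k : α} (h : ReflTransGen E c k) :
    ∃ τ : Equiv.Perm α, τ k = c ∧ ∀ p, τ p ≠ p →
      ReflTransGen E c p ∧ ReflTransGen E p k ∧ (p ≠ k → E p (τ p)) := by
  induction h using ReflTransGen.head_induction_on with
  | refl => exact ⟨1, rfl, fun p hp => absurd rfl hp⟩
  | @head c c' hcc' hreach ih =>
    obtain ⟨τ, hτk, hτ⟩ := ih
    have hcyc : ¬ ReflTransGen E c' c := fun hc =>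
      wf.transGen.asymmetric _ _ (TransGen.head' hcc' hc) (TransGen.head' hcc' hc)
    have hc : τ c = c := by
      by_contra hne
      exact hcyc (hτ c hne).1
    have hck : c ≠ k := by
      rintro rfl
      exact hcyc hreach
    refine ⟨τ * Equiv.swap c k, by simp [hc], fun p hp => ?_⟩
    by_cases hpc : p = c
    · subst hpc
      refine ⟨.refl, .head hcc' hreach, fun _ => ?_⟩
      simpa [hτk] using hcc'
    by_cases hpk : p = k
    · subst hpk
      exact ⟨.head hcc' hreach, .refl, fun h => absurd rfl h⟩
    · have hs : (τ * Equiv.swap c k) p = τ p := by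
        simp [Equiv.swap_apply_of_ne_of_ne hpc hpk]
      rw [hs] at hp ⊢
      obtain ⟨h1, h2, h3⟩ := hτ p hp
      exact ⟨.head hcc' h1, h2, h3⟩

open Relation in
/-- Two paths can be shifted simultaneously if the end of the first one is not reachable from the
start of the second one. -/
theorem exists_perm_shift_pair {α : Type*} [DecidableEq α] {E : α → α → Prop}
    (wf : WellFounded E) {c k d l : α} (hck : ReflTransGen E c k) (hdl : ReflTransGen E d l)
    (hdk : ¬ ReflTransGen E d k) :
    ∃ τ : Equiv.Perm α, τ k = c ∧ τ l = d ∧ ∀ p, p ≠ k → p ≠ l → τ p = p ∨ E p (τ p) := by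
  obtain ⟨τ₁, h₁, H₁⟩ := exists_perm_shift wf hck
  obtain ⟨τ₂, h₂, H₂⟩ := exists_perm_shift wf hdl
  have fix₁ : ∀ p, ReflTransGen E d p → τ₁ p = p := fun p hp => by
    by_contra hne
    exact hdk (hp.trans (H₁ p hne).2.1)
  have fix₂ : τ₂ k = k := by
    by_contra hne
    exact hdk (H₂ k hne).1
  refine ⟨τ₁ * τ₂, by simp [fix₂, h₁], by simp [h₂, fix₁ d .refl], fun p hpk hpl => ?_⟩
  by_cases hp : τ₂ p = p
  · by_cases hp' : τ₁ p = p
    · left; simp [hp, hp']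
    · right; simpa [hp] using (H₁ p hp').2.2 hpk
  · obtain ⟨hdp, -, hE⟩ := H₂ p hp
    right
    simpa [fix₁ _ (hdp.tail (hE hpl))] using hE hpl

/-- A self-map of a finite nonempty type has a periodic point. -/
theorem exists_mem_periodicPts {β : Type*} [Finite β] [Nonempty β] (f : β → β) :
    ∃ x, x ∈ Function.periodicPts f := by
  obtain ⟨x₀⟩ := ‹Nonempty β›
  obtain ⟨m, n, hne, heq⟩ := Finite.exists_ne_map_eq_of_infinite (fun n : ℕ => f^[n] x₀)
  wlog hlt : m < n generalizing m n
  · exact this n m hne.symm heq.symm (lt_of_le_of_ne (not_lt.mp hlt) hne.symm)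
  refine ⟨f^[m] x₀, Function.mk_mem_periodicPts (Nat.sub_pos_of_lt hlt) ?_⟩
  change f^[n - m] (f^[m] x₀) = f^[m] x₀
  rw [← Function.iterate_add_apply, Nat.sub_add_cancel hlt.le]
  exact heq.symm

/-- If no nontrivial permutation moves every point to itself or to a successor, then a finite
irreflexive relation is well-founded. -/
theorem wellFounded_of_forall_perm_eq_one {α : Type*} [Finite α] {E : α → α → Prop}
    (hirr : ∀ p, ¬ E p p)
    (hperm : ∀ τ : Equiv.Perm α, (∀ p, τ p = p ∨ E p (τ p)) → τ = 1) : WellFounded E := by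
  classical
  rw [WellFounded.wellFounded_iff_has_min]
  intro s hs
  by_contra! hmin
  choose! f hfs hfE using hmin
  let F : s → s := fun m => ⟨f m, hfs m m.2⟩
  have := hs.to_subtype
  obtain ⟨x, hx⟩ := exists_mem_periodicPts F
  let e : Equiv.Perm (Function.periodicPts F) := (Function.bijOn_periodicPts F).equiv
  have he : ∀ y, ((e y : s) : α) = f (y : s) := fun _ => rfl
  let τ : Equiv.Perm α := Equiv.Perm.ofSubtype (Equiv.Perm.ofSubtype e.symm : Equiv.Perm s)
  have hτ : ∀ y : Function.periodicPts F, τ (e y : s) = (y : s) := fun y => by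
    simp only [τ, Equiv.Perm.ofSubtype_apply_coe, Equiv.symm_apply_apply]
  have hone : τ = 1 := hperm τ fun p => by
    by_cases hp : ∃ y : Function.periodicPts F, ((e y : s) : α) = p
    · obtain ⟨y, rfl⟩ := hp
      right
      rw [hτ, he]
      exact hfE _ (y : s).2
    · left
      by_cases hps : p ∈ s
      · have : τ ((⟨p, hps⟩ : s) : α) = p := by
          have hnot : (⟨p, hps⟩ : s) ∉ Function.periodicPts F := fun hmem =>
            hp ⟨e.symm ⟨_, hmem⟩, by rw [Equiv.apply_symm_apply]⟩
          rw [Equiv.Perm.ofSubtype_apply_coe, Equiv.Perm.ofSubtype_apply_of_not_mem _ hnot]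
        exact this
      · exact Equiv.Perm.ofSubtype_apply_of_not_mem _ hps
  have h1 := hτ ⟨x, hx⟩
  rw [hone, he] at h1
  have h2 := hfE _ x.2
  simp only [Equiv.Perm.one_apply] at h1
  rw [h1] at h2
  exact hirr _ h2

open Relation in
/-- In a well-founded relation every point is reachable from a point without predecessors. -/
theorem WellFounded.exists_source {α : Type*} {E : α → α → Prop} (wf : WellFounded E) (a : α) :
    ∃ s, (∀ p, ¬ E p s) ∧ ReflTransGen E s a := by
  induction a using wf.induction with
  | _ a ih =>
    by_cases h : ∃ p, E p a
    · obtain ⟨p, hp⟩ := h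
      obtain ⟨s, hs, hsp⟩ := ih p hp
      exact ⟨s, hs, hsp.tail hp⟩
    · exact ⟨a, fun p hp => h ⟨p, hp⟩, .refl⟩

open Relation in
/-- An assignment in which only the agent at `r` is dissatisfied can be repaired. Agent `p` values
bundle `q` at `c p q` and is satisfied with value at least `max (y p) (m p)`; `ρ` is a fallback
assignment guaranteeing the values `y`. -/
theorem exists_perm_forall_satisfied {α : Type*} [Fintype α] [DecidableEq α]
    {E : α → α → Prop} (wf : WellFounded E) (c : α → α → ℝ) (y m h : α → ℝ)
    (ρ : Equiv.Perm α) (s r : α)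
    (hy : ∀ p, y p ≤ h p) (hm : ∀ p, m p ≤ h p)
    (hc : ∀ p, p ≠ r → h p ≤ c p p) (hcE : ∀ p q, E p q → q ≠ r → h p ≤ c p q)
    (hρ : ∀ p, y p ≤ c p (ρ p))
    (hs : ∃ k, ReflTransGen E s k ∧ h k < c k r)
    (hr : ∀ k, ReflTransGen E r k → c k r ≤ h k)
    (hsr : ∀ a, c a r < m a → m a ≤ c a s) :
    ∃ π : Equiv.Perm α, ∀ p, y p ≤ c p (π p) ∧ m p ≤ c p (π p) := by
  let G : Set α := {p | ∃ k, ReflTransGen E p k ∧ h k < c k r}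
  have hrG : r ∉ G := fun ⟨k, hk, hlt⟩ => absurd (hr k hk) (not_le.mpr hlt)
  suffices H : ∀ (N : ℕ) (π : Equiv.Perm α) (a : α), π a = r → a ∉ G → (∀ g ∈ G, π g = g) →
      (∀ p, p ≠ a → y p ≤ c p (π p) ∧ m p ≤ c p (π p)) →
      (Finset.univ.filter fun p => π p ≠ ρ p).card < N →
      ∃ π : Equiv.Perm α, ∀ p, y p ≤ c p (π p) ∧ m p ≤ c p (π p) from
    H _ 1 r rfl hrG (fun _ _ => rfl)
      (fun p hp => ⟨(hy p).trans (hc p hp), (hm p).trans (hc p hp)⟩) (Nat.lt_succ_self _)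
  intro N
  induction N with
  | zero => exact fun _ _ _ _ _ _ hcard => absurd hcard (Nat.not_lt_zero _)
  | succ N ih =>
    intro π a hπa haG hG hgood hcard
    by_cases har : y a ≤ c a r ∧ m a ≤ c a r
    · refine ⟨π, fun p => ?_⟩
      by_cases hpa : p = a
      · subst hpa
        rwa [hπa]
      · exact hgood p hpa
    by_cases hb : ∃ b ∈ G, y a ≤ c a b ∧ m a ≤ c a b
    · obtain ⟨b, ⟨k, hbk, hk⟩, hab⟩ := hb
      obtain ⟨τ, hτk, hτ⟩ := exists_perm_shift wf hbk
      have hτG : ∀ p, τ p ≠ p → p ∈ G := fun p hp => ⟨k, (hτ p hp).2.1, hk⟩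
      have hτa : τ a = a := by
        by_contra hne
        exact haG (hτG a hne)
      have hak : a ≠ k := by
        rintro rfl
        exact haG ⟨a, .refl, hk⟩
      refine ⟨π * τ * Equiv.swap a k, fun p => ?_⟩
      by_cases hpa : p = a
      · subst hpa
        simpa [hτk, hG b ⟨k, hbk, hk⟩] using hab
      by_cases hpk : p = k
      · subst hpk
        simpa [hτa, hπa] using And.intro ((hy p).trans hk.le) ((hm p).trans hk.le)
      have hp : (π * τ * Equiv.swap a k) p = π (τ p) := by
        simp [Equiv.swap_apply_of_ne_of_ne hpa hpk]
      rw [hp]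
      by_cases hmov : τ p = p
      · rw [hmov]
        exact hgood p hpa
      · have hmem : τ p ∈ G := hτG _ fun heq => hmov (τ.injective heq)
        rw [hG _ hmem]
        have hle := hcE p (τ p) ((hτ p hmov).2.2 hpk) fun heq => hrG (heq ▸ hmem)
        exact ⟨(hy p).trans hle, (hm p).trans hle⟩
    have hmy : m a ≤ y a := by
      by_contra! hlt
      have hcm : c a r < m a := by
        by_contra! hle
        exact har ⟨hlt.le.trans hle, hle⟩
      exact hb ⟨s, hs, hlt.le.trans (hsr a hcm), hsr a hcm⟩
    have hρr : ρ a ≠ r := fun heq => har (by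
      have := hρ a
      rw [heq] at this
      exact ⟨this, hmy.trans this⟩)
    obtain ⟨b, hπb⟩ := π.surjective (ρ a)
    have hba : b ≠ a := by
      rintro rfl
      exact hρr (hπb.symm.trans hπa)
    have hbG : b ∉ G := fun hbG =>
      hb ⟨b, hbG, by
        rw [← hG b hbG, hπb]
        exact ⟨hρ a, hmy.trans (hρ a)⟩⟩
    have hswap : ∀ p, p ≠ a → p ≠ b → (π * Equiv.swap a b) p = π p := fun p hpa hpb => by
      simp [Equiv.swap_apply_of_ne_of_ne hpa hpb]
    have hswa : (π * Equiv.swap a b) a = ρ a := by simp [hπb]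
    refine ih (π * Equiv.swap a b) b (by simp [hπa]) hbG (fun g hg => ?_) (fun p hpb => ?_) ?_
    · rw [hswap g (fun h => haG (h ▸ hg)) (fun h => hbG (h ▸ hg)), hG g hg]
    · by_cases hpa : p = a
      · subst hpa
        rw [hswa]
        exact ⟨hρ p, hmy.trans (hρ p)⟩
      · rw [hswap p hpa hpb]
        exact hgood p hpa
    · refine lt_of_lt_of_le (Finset.card_lt_card ?_) (Nat.lt_succ_iff.mp hcard)
      rw [Finset.ssubset_iff_of_subset]
      · refine ⟨a, ?_, ?_⟩
        · simpa [hπa] using hρr.symm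
        · exact fun hmem => (Finset.mem_filter.mp hmem).2 hswa
      · intro p
        simp only [Finset.mem_filter, Finset.mem_univ, true_and]
        intro hp
        by_cases hpa : p = a
        · subst hpa
          exact absurd hswa hp
        by_cases hpb : p = b
        · subst hpb
          rw [hπb]
          exact fun h => hba (ρ.injective h).symm
        · rwa [hswap p hpa hpb] at hp

/-- Starting from bundles indexed by `α`, where agent `p` values the `q`-th bundle with the
items `V` added at `w p q V`, each bundle `q` receives the new items `U q ⊆ T` and is assigned to
the agents by `σ`. Every agent gets at least the value of its old bundle `ρ p`, and does not prefer
a bundle from which one of the new items is removed. -/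
structure IsTopUp {α ι : Type*} [DecidableEq ι] (w : α → α → Finset ι → ℝ) (ρ : Equiv.Perm α)
    (T : Finset ι) (σ : Equiv.Perm α) (U : α → Finset ι) : Prop where
  subset : ∀ q, U q ⊆ T
  disjoint : ∀ q q', q ≠ q' → Disjoint (U q) (U q')
  base_le : ∀ p, w p (ρ p) ∅ ≤ w p (σ p) (U (σ p))
  erase_le : ∀ p q, ∀ u ∈ U q, w p q ((U q).erase u) ≤ w p (σ p) (U (σ p))

/-- The top-up that adds `A` to the bundle `s` and `B` to the bundle `r`. -/
def pairTopUp {α ι : Type*} [DecidableEq α] (s r : α) (A B : Finset ι) (q : α) : Finset ι :=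
  if q = s then A else if q = r then B else ∅

theorem pairTopUp_fst {α ι : Type*} [DecidableEq α] (s r : α) (A B : Finset ι) :
    pairTopUp s r A B s = A := if_pos rfl

theorem pairTopUp_snd {α ι : Type*} [DecidableEq α] {s r : α} (hsr : s ≠ r)
    (A B : Finset ι) : pairTopUp s r A B r = B := by
  simp [pairTopUp, hsr.symm]

theorem pairTopUp_of_ne {α ι : Type*} [DecidableEq α] {s r q : α} (hqs : q ≠ s)
    (hqr : q ≠ r) (A B : Finset ι) :
    pairTopUp s r A B q = ∅ := by
  simp [pairTopUp, hqs, hqr]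

theorem pairTopUp_subset {α ι : Type*} [DecidableEq α] {s r : α} {A B T : Finset ι}
    (hA : A ⊆ T) (hB : B ⊆ T) (q : α) :
    pairTopUp s r A B q ⊆ T := by
  unfold pairTopUp
  split_ifs <;> simp [hA, hB]

theorem pairTopUp_disjoint {α ι : Type*} [DecidableEq α] {s r : α} {A B : Finset ι}
    (hAB : Disjoint A B) (q q' : α)
    (hqq' : q ≠ q') : Disjoint (pairTopUp s r A B q) (pairTopUp s r A B q') := by
  unfold pairTopUp
  split_ifs <;> simp_all [disjoint_comm]

/-- The top-up `U` with the identity assignment is lexicographically Pareto-maximal: first in the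
values of the agents, then in the number of added items. -/
structure IsMaxTopUp {α ι : Type*} [Fintype α] [DecidableEq ι] (w : α → α → Finset ι → ℝ)
    (ρ : Equiv.Perm α) (T : Finset ι) (U : α → Finset ι) : Prop where
  isTopUp : IsTopUp w ρ T 1 U
  le_of_le : ∀ σ V, IsTopUp w ρ T σ V → (∀ p, w p p (U p) ≤ w p (σ p) (V (σ p))) →
    ∀ p, w p (σ p) (V (σ p)) ≤ w p p (U p)
  card_le_of_le : ∀ σ V, IsTopUp w ρ T σ V → (∀ p, w p p (U p) ≤ w p (σ p) (V (σ p))) →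
    ∑ q, (V q).card ≤ ∑ q, (U q).card

theorem IsMaxTopUp.isTopUp_of_le {α ι : Type*} [Fintype α] [DecidableEq ι]
    {w : α → α → Finset ι → ℝ} {ρ : Equiv.Perm α} {T : Finset ι} {U : α → Finset ι}
    (hU : IsMaxTopUp w ρ T U) {σ : Equiv.Perm α} {V : α → Finset ι}
    (hsub : ∀ q, V q ⊆ T) (hdisj : ∀ q q', q ≠ q' → Disjoint (V q) (V q'))
    (hle : ∀ p, w p p (U p) ≤ w p (σ p) (V (σ p)))
    (herase : ∀ p q, ∀ u ∈ V q, w p q ((V q).erase u) ≤ w p p (U p)) : IsTopUp w ρ T σ V :=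
  ⟨hsub, hdisj, fun p => (hU.isTopUp.base_le p).trans (hle p),
    fun p q u hu => (herase p q u hu).trans (hle p)⟩

namespace IsMaxTopUp

open Relation

variable {α ι : Type*} [Fintype α] [DecidableEq ι] {w : α → α → Finset ι → ℝ}
  {ρ : Equiv.Perm α} {T : Finset ι} {U : α → Finset ι}

/-- Agent `p` envies agent `q`. -/
def Envies (w : α → α → Finset ι → ℝ) (U : α → Finset ι) (p q : α) : Prop :=
  w p p (U p) < w p q (U q)

theorem wellFounded_envies (hU : IsMaxTopUp w ρ T U) : WellFounded (Envies w U) := by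
  refine wellFounded_of_forall_perm_eq_one (fun p => lt_irrefl _) fun τ hτ => ?_
  have hle : ∀ p, w p p (U p) ≤ w p (τ p) (U (τ p)) := fun p => by
    rcases hτ p with h | h
    · rw [h]
    · exact le_of_lt h
  have htop := hU.isTopUp_of_le hU.isTopUp.subset hU.isTopUp.disjoint hle hU.isTopUp.erase_le
  ext p
  rcases hτ p with h | h
  · exact h
  · exact absurd (hU.le_of_le τ U htop hle p) (not_le.mpr h)

variable [DecidableEq α]

/-- A new item cannot be added to an unenvied bundle without creating strong envy. -/
theorem exists_lt_insert_erase (hU : IsMaxTopUp w ρ T U)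
    (hmono : ∀ p q, Monotone (w p q)) {z : ι} (hzT : z ∈ T)
    (hz : ∀ q, z ∉ U q) {s : α} (hs : ∀ p, ¬ Envies w U p s) :
    ∃ u ∈ U s, ∃ p, w p p (U p) < w p s (insert z ((U s).erase u)) := by
  by_contra! hcon
  let V : α → Finset ι := Function.update U s (insert z (U s))
  have hVs : V s = insert z (U s) := Function.update_self ..
  have hVq : ∀ q, q ≠ s → V q = U q := fun q hq => Function.update_of_ne hq ..
  have hUV : ∀ q, U q ⊆ V q := fun q => by
    by_cases hq : q = s
    · subst hq
      rw [hVs]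
      exact Finset.subset_insert _ _
    · rw [hVq q hq]
  have hle : ∀ p, w p p (U p) ≤ w p ((1 : Equiv.Perm α) p) (V ((1 : Equiv.Perm α) p)) :=
    fun p => hmono p p (hUV p)
  have htop : IsTopUp w ρ T 1 V := by
    refine hU.isTopUp_of_le (fun q => ?_) (fun q q' hqq' => ?_) hle fun p q u hu => ?_
    · by_cases hq : q = s
      · subst hq
        rw [hVs]
        exact Finset.insert_subset hzT (hU.isTopUp.subset q)
      · rw [hVq q hq]
        exact hU.isTopUp.subset q
    · have hd := hU.isTopUp.disjoint q q' hqq'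
      by_cases hq : q = s
      · subst hq
        rw [hVs, hVq q' hqq'.symm, Finset.disjoint_insert_left]
        exact ⟨hz q', hd⟩
      · by_cases hq' : q' = s
        · subst hq'
          rw [hVs, hVq q hq, Finset.disjoint_insert_right]
          exact ⟨hz q, hd⟩
        · rwa [hVq q hq, hVq q' hq']
    · by_cases hq : q = s
      · subst hq
        rw [hVs] at hu ⊢
        by_cases huz : u = z
        · subst huz
          rw [Finset.erase_insert (hz q)]
          exact not_lt.mp (hs p)
        · rw [Finset.erase_insert_of_ne (Ne.symm huz)]
          exact hcon u (Finset.mem_of_mem_insert_of_ne hu huz) p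
      · rw [hVq q hq] at hu ⊢
        exact hU.isTopUp.erase_le p q u hu
  have hcard := hU.card_le_of_le 1 V htop hle
  refine absurd hcard (not_le.mpr (Finset.sum_lt_sum (fun q _ => Finset.card_le_card (hUV q))
    ⟨s, Finset.mem_univ s, ?_⟩))
  rw [hVs, Finset.card_insert_of_notMem (hz s)]
  exact Nat.lt_succ_self _

/-- The items added to an unenvied bundle `s` cannot be replaced by a set that some agent
reachable from `s` would envy. -/
theorem le_of_reflTransGen (hU : IsMaxTopUp w ρ T U) {s a : α}
    (hsa : ReflTransGen (Envies w U) s a) {V : Finset ι} (hVT : V ⊆ T)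
    (hV : ∀ q, q ≠ s → Disjoint V (U q))
    (herase : ∀ p, ∀ u ∈ V, w p s (V.erase u) ≤ w p p (U p)) :
    w a s V ≤ w a a (U a) := by
  by_contra! hlt
  obtain ⟨τ, hτa, hτ⟩ := exists_perm_shift hU.wellFounded_envies hsa
  let W : α → Finset ι := Function.update U s V
  have hWs : W s = V := Function.update_self ..
  have hWq : ∀ q, q ≠ s → W q = U q := fun q hq => Function.update_of_ne hq ..
  have hle : ∀ p, w p p (U p) ≤ w p (τ p) (W (τ p)) := fun p => by
    by_cases hpa : p = a
    · subst hpa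
      rw [hτa, hWs]
      exact hlt.le
    · have hne : τ p ≠ s := fun h => hpa (τ.injective (h.trans hτa.symm))
      rw [hWq _ hne]
      by_cases hp : τ p = p
      · rw [hp]
      · exact le_of_lt ((hτ p hp).2.2 hpa)
  have htop : IsTopUp w ρ T τ W := by
    refine hU.isTopUp_of_le (fun q => ?_) (fun q q' hqq' => ?_) hle fun p q u hu => ?_
    · by_cases hq : q = s
      · subst hq
        rwa [hWs]
      · rw [hWq q hq]
        exact hU.isTopUp.subset q
    · by_cases hq : q = s
      · subst hq
        rw [hWs, hWq q' hqq'.symm]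
        exact hV q' hqq'.symm
      · by_cases hq' : q' = s
        · subst hq'
          rw [hWs, hWq q hq]
          exact (hV q hq).symm
        · rw [hWq q hq, hWq q' hq']
          exact hU.isTopUp.disjoint q q' hqq'
    · by_cases hq : q = s
      · subst hq
        rw [hWs] at hu ⊢
        exact herase p u hu
      · rw [hWq q hq] at hu ⊢
        exact hU.isTopUp.erase_le p q u hu
  have hfin := hU.le_of_le τ W htop hle a
  rw [hτa, hWs] at hfin
  exact absurd hfin (not_le.mpr hlt)

/-- A maximal top-up with a single unenvied bundle uses all items. -/
theorem complete_of_unique_source (hU : IsMaxTopUp w ρ T U) (hmono : ∀ p q, Monotone (w p q))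
    {s : α} (hs : ∀ p, ¬ Envies w U p s)
    (hreach : ∀ a, ReflTransGen (Envies w U) s a) {z : ι} (hzT : z ∈ T) : ∃ q, z ∈ U q := by
  by_contra! hz
  have key : ∀ V : Finset ι, V ⊆ insert z (U s) → ∀ a, w a s V ≤ w a a (U a) := by
    intro V
    induction V using Finset.strongInduction with
    | _ V ih =>
      intro hV a
      refine hU.le_of_reflTransGen (hreach a)
        (hV.trans (Finset.insert_subset hzT (hU.isTopUp.subset s))) (fun q hq => ?_)
        fun p u hu => ih _ (Finset.erase_ssubset hu) ((Finset.erase_subset _ _).trans hV) p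
      refine Finset.disjoint_of_subset_left hV ?_
      rw [Finset.disjoint_insert_left]
      exact ⟨hz q, hU.isTopUp.disjoint s q hq.symm⟩
  obtain ⟨u, -, p, hp⟩ := hU.exists_lt_insert_erase hmono hzT hz hs
  exact absurd (key _ (Finset.insert_subset_insert z (Finset.erase_subset u _)) p)
    (not_le.mpr hp)

/-- In a maximal top-up with two augmented bundles no two agents can improve by exchanging the
added items for single items along shifted paths. -/
theorem not_lt_of_perm (hU : IsMaxTopUp w ρ T U) {s r : α} (hsr : s ≠ r)
    (hUq : ∀ q, q ≠ s → q ≠ r → U q = ∅)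
    (hs : ∀ p, w p s ∅ ≤ w p p (U p)) (hr : ∀ p, w p r ∅ ≤ w p p (U p))
    {t₁ t₂ : ι} (ht₁ : t₁ ∈ T) (ht₂ : t₂ ∈ T) (ht : t₁ ≠ t₂) {a b : α}
    {τ : Equiv.Perm α} (hτa : τ a = s) (hτb : τ b = r)
    (hτ : ∀ p, p ≠ a → p ≠ b → τ p = p ∨ Envies w U p (τ p))
    (ha : w a a (U a) < w a s {t₁}) : ¬ w b b (U b) < w b r {t₂} := by
  intro hb
  have hle : ∀ p, w p p (U p) ≤ w p (τ p) (pairTopUp s r {t₁} {t₂} (τ p)) := fun p => by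
    by_cases hpa : p = a
    · subst hpa
      rw [hτa, pairTopUp_fst]
      exact ha.le
    by_cases hpb : p = b
    · subst hpb
      rw [hτb, pairTopUp_snd hsr]
      exact hb.le
    have h1 : τ p ≠ s := fun h => hpa (τ.injective (h.trans hτa.symm))
    have h2 : τ p ≠ r := fun h => hpb (τ.injective (h.trans hτb.symm))
    rw [pairTopUp_of_ne h1 h2, ← hUq _ h1 h2]
    rcases hτ p hpa hpb with h | h
    · rw [h]
    · exact le_of_lt h
  have htop : IsTopUp w ρ T τ (pairTopUp s r {t₁} {t₂}) := by
    refine hU.isTopUp_of_le (pairTopUp_subset (by simpa) (by simpa))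
      (pairTopUp_disjoint (by simpa)) hle fun p q u hu => ?_
    by_cases hqs : q = s
    · subst hqs
      rw [pairTopUp_fst] at hu ⊢
      rw [Finset.mem_singleton.mp hu, Finset.erase_singleton]
      exact hs p
    by_cases hqr : q = r
    · subst hqr
      rw [pairTopUp_snd hsr] at hu ⊢
      rw [Finset.mem_singleton.mp hu, Finset.erase_singleton]
      exact hr p
    · simp [pairTopUp_of_ne hqs hqr] at hu
  have := hU.le_of_le τ _ htop hle a
  rw [hτa, pairTopUp_fst] at this
  exact absurd this (not_le.mpr ha)

/-- With two unenvied bundles `s` and `r` carrying one new item each, such that no agent would envy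
`s` carrying the item of `r`, all three items can be placed. -/
theorem exists_isTopUp_of_forall_le (hU : IsMaxTopUp w ρ T U) (hmono : ∀ p q, Monotone (w p q))
    {s r : α} (hsr : s ≠ r) {x y z : ι} (hT : T = {x, y, z}) (hxy : x ≠ y) (hxz : x ≠ z)
    (hyz : y ≠ z) (hUs : U s = {x}) (hUr : U r = {y}) (hUq : ∀ q, q ≠ s → q ≠ r → U q = ∅)
    (hs : ∀ p, ¬ Envies w U p s) (hr : ∀ p, ¬ Envies w U p r)
    (hk : ∃ k, ReflTransGen (Envies w U) s k ∧ w k k (U k) < w k r {z})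
    (hy : ∀ p, w p s {y} ≤ w p p (U p)) :
    ∃ σ V, IsTopUp w ρ T σ V ∧ ∀ t ∈ T, ∃ q, t ∈ V q := by
  have hr₀ : ∀ p, w p r ∅ ≤ w p p (U p) := fun p =>
    (hmono p r (Finset.empty_subset _)).trans (not_lt.mp (hr p))
  let V := pairTopUp s r {x, y} {z}
  have hVs : V s = {x, y} := pairTopUp_fst ..
  have hVr : V r = {z} := pairTopUp_snd hsr ..
  have hVq : ∀ q, q ≠ s → q ≠ r → V q = ∅ := fun q h1 h2 => pairTopUp_of_ne h1 h2 ..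
  have hUV : ∀ q, q ≠ r → U q ⊆ V q := fun q hq => by
    by_cases hqs : q = s
    · subst hqs
      simp [hUs, hVs]
    · simp [hUq q hqs hq]
  let m : α → ℝ := fun p => max (max (w p s {x}) (w p s {y})) (w p r ∅)
  obtain ⟨π, hπ⟩ := exists_perm_forall_satisfied hU.wellFounded_envies
    (fun p q => w p q (V q)) (fun p => w p (ρ p) ∅) m (fun p => w p p (U p)) ρ s r
    hU.isTopUp.base_le
    (fun p => max_le (max_le (by simpa [Envies, hUs] using hs p) (hy p)) (hr₀ p))
    (fun p hp => hmono p p (hUV p hp))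
    (fun p q hpq hq => (le_of_lt hpq).trans (hmono p q (hUV q hq)))
    (fun p => hmono _ _ (Finset.empty_subset _))
    (by simpa only [hVr] using hk)
    (fun k hrk => by
      simp only [hVr]
      refine hU.le_of_reflTransGen hrk (by simp [hT]) (fun q hq => ?_) fun p u hu => ?_
      · by_cases hqs : q = s
        · subst hqs
          simpa [hUs] using hxz.symm
        · simp [hUq q hqs hq]
      · rw [Finset.mem_singleton.mp hu, Finset.erase_singleton]
        exact hr₀ p)
    (fun a ha => by
      simp only [hVr, hVs, m] at ha ⊢
      have h1 : w a r ∅ ≤ w a r {z} := hmono a r (Finset.empty_subset _)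
      have h2 : w a s {x} ≤ w a s {x, y} := hmono a s (by simp)
      have h3 : w a s {y} ≤ w a s {x, y} := hmono a s (by simp)
      refine max_le (max_le h2 h3) ?_
      rcases lt_max_iff.mp ha with h | h
      · exact h1.trans (h.le.trans (max_le h2 h3))
      · exact absurd h1 (not_le.mpr h))
  refine ⟨π, V, ⟨pairTopUp_subset (by simp [hT, Finset.insert_subset_iff]) (by simp [hT]),
    pairTopUp_disjoint (by simp [hxz.symm, hyz.symm]), fun p => (hπ p).1, fun p q u hu => ?_⟩, ?_⟩
  · have hm := (hπ p).2
    simp only [m, max_le_iff] at hm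
    by_cases hqs : q = s
    · subst hqs
      rw [hVs] at hu ⊢
      rcases Finset.mem_insert.mp hu with rfl | hu
      · rw [Finset.erase_insert (by simpa)]
        exact hm.1.2
      · rw [Finset.mem_singleton.mp hu, Finset.pair_comm,
          Finset.erase_insert (by simpa using hxy.symm)]
        exact hm.1.1
    by_cases hqr : q = r
    · subst hqr
      rw [hVr] at hu ⊢
      rw [Finset.mem_singleton.mp hu, Finset.erase_singleton]
      exact hm.2
    · simp [hVq q hqs hqr] at hu
  · intro t ht
    rw [hT] at ht
    simp only [Finset.mem_insert, Finset.mem_singleton] at ht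
    rcases ht with rfl | rfl | rfl
    · exact ⟨s, by simp [hVs]⟩
    · exact ⟨s, by simp [hVs]⟩
    · exact ⟨r, by simp [hVr]⟩

/-- If there are at most three new items, all of them can be distributed. -/
theorem exists_isTopUp_complete [Nonempty α] (hU : IsMaxTopUp w ρ T U)
    (hmono : ∀ p q, Monotone (w p q)) (hcard : T.card ≤ 3) :
    ∃ σ V, IsTopUp w ρ T σ V ∧ ∀ t ∈ T, ∃ q, t ∈ V q := by
  by_cases hcomp : ∀ t ∈ T, ∃ q, t ∈ U q
  · exact ⟨1, U, hU.isTopUp, hcomp⟩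
  push Not at hcomp
  obtain ⟨z, hzT, hz⟩ := hcomp
  have wf := hU.wellFounded_envies
  obtain ⟨s, hs, -⟩ := wf.exists_source (Classical.arbitrary α)
  by_cases hall : ∀ a, ReflTransGen (Envies w U) s a
  · obtain ⟨q, hq⟩ := hU.complete_of_unique_source hmono hs hall hzT
    exact absurd hq (hz q)
  push Not at hall
  obtain ⟨a, ha⟩ := hall
  obtain ⟨r, hr, hra⟩ := wf.exists_source a
  have hsr : s ≠ r := by
    rintro rfl
    exact ha hra
  obtain ⟨x, hx, j, hj⟩ := hU.exists_lt_insert_erase hmono hzT hz hs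
  obtain ⟨y, hy, k, hk⟩ := hU.exists_lt_insert_erase hmono hzT hz hr
  have hnot : ∀ {t q q'}, q ≠ q' → t ∈ U q → t ∉ U q' := fun hne ht =>
    Finset.disjoint_left.mp (hU.isTopUp.disjoint _ _ hne) ht
  have hxy : x ≠ y := by
    rintro rfl
    exact hnot hsr hx hy
  have hxz : x ≠ z := by
    rintro rfl
    exact hz s hx
  have hyz : y ≠ z := by
    rintro rfl
    exact hz r hy
  have hxT := hU.isTopUp.subset s hx
  have hyT := hU.isTopUp.subset r hy
  have hT : T = {x, y, z} := by
    refine (Finset.eq_of_subset_of_card_le ?_ ?_).symm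
    · simp [Finset.insert_subset_iff, hxT, hyT, hzT]
    · rwa [Finset.card_eq_three.mpr ⟨x, y, z, hxy, hxz, hyz, rfl⟩]
  have hcases : ∀ {t q}, t ∈ U q → t = x ∨ t = y := fun {t q} ht => by
    have hmem := hU.isTopUp.subset q ht
    simp only [hT, Finset.mem_insert, Finset.mem_singleton] at hmem
    rcases hmem with rfl | rfl | rfl
    · exact .inl rfl
    · exact .inr rfl
    · exact absurd ht (hz q)
  have hUs : U s = {x} := by
    refine Finset.eq_singleton_iff_unique_mem.mpr ⟨hx, fun t ht => ?_⟩
    exact (hcases ht).resolve_right fun h => hnot hsr ht (h ▸ hy)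
  have hUr : U r = {y} := by
    refine Finset.eq_singleton_iff_unique_mem.mpr ⟨hy, fun t ht => ?_⟩
    exact (hcases ht).resolve_left fun h => hnot hsr.symm ht (h ▸ hx)
  have hUq : ∀ q, q ≠ s → q ≠ r → U q = ∅ := fun q hqs hqr => by
    refine Finset.eq_empty_of_forall_notMem fun t ht => ?_
    rcases hcases ht with rfl | rfl
    · exact hnot hqs ht hx
    · exact hnot hqr ht hy
  have hreach : ∀ a, ReflTransGen (Envies w U) s a ∨ ReflTransGen (Envies w U) r a := fun a => by
    obtain ⟨s', hs', hs'a⟩ := wf.exists_source a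
    by_cases h1 : s' = s
    · exact .inl (h1 ▸ hs'a)
    by_cases h2 : s' = r
    · exact .inr (h2 ▸ hs'a)
    obtain ⟨u, hu, -⟩ := hU.exists_lt_insert_erase hmono hzT hz hs'
    simp [hUq s' h1 h2] at hu
  have hs₀ : ∀ p, w p s ∅ ≤ w p p (U p) := fun p =>
    (hmono p s (Finset.empty_subset _)).trans (not_lt.mp (hs p))
  have hr₀ : ∀ p, w p r ∅ ≤ w p p (U p) := fun p =>
    (hmono p r (Finset.empty_subset _)).trans (not_lt.mp (hr p))
  have hj' : w j j (U j) < w j s {z} := by simpa [hUs] using hj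
  have hk' : w k k (U k) < w k r {z} := by simpa [hUr] using hk
  have hz_le : ∀ {c a}, (∀ p, w p c ∅ ≤ w p p (U p)) → ReflTransGen (Envies w U) c a →
      w a c {z} ≤ w a a (U a) := fun {c a} hc hca => by
    refine hU.le_of_reflTransGen hca (by simpa) (fun q _ => by simpa using hz q) fun p u hu => ?_
    rw [Finset.mem_singleton.mp hu, Finset.erase_singleton]
    exact hc p
  have hsj : ¬ ReflTransGen (Envies w U) s j := fun h => absurd (hz_le hs₀ h) (not_le.mpr hj')
  have hrk : ¬ ReflTransGen (Envies w U) r k := fun h => absurd (hz_le hr₀ h) (not_le.mpr hk')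
  have hrj := (hreach j).resolve_left hsj
  have hsk := (hreach k).resolve_right hrk
  by_cases hSy : ∀ p, w p s {y} ≤ w p p (U p)
  · exact hU.exists_isTopUp_of_forall_le hmono hsr hT hxy hxz hyz hUs hUr hUq hs hr
      ⟨k, hsk, hk'⟩ hSy
  by_cases hRx : ∀ p, w p r {x} ≤ w p p (U p)
  · exact hU.exists_isTopUp_of_forall_le hmono hsr.symm (hT.trans (Finset.insert_comm ..))
      hxy.symm hyz hxz hUr hUs (fun q h1 h2 => hUq q h2 h1) hr hs ⟨j, hrj, hj'⟩ hRx
  exfalso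
  push Not at hSy hRx
  obtain ⟨b, hb⟩ := hSy
  obtain ⟨c, hc⟩ := hRx
  have swap_ne : ∀ {a b p : α}, p ≠ a → p ≠ b → Equiv.swap a b p = p := fun h1 h2 =>
    Equiv.swap_apply_of_ne_of_ne h1 h2
  by_cases hrb : ReflTransGen (Envies w U) r b
  · obtain ⟨τ, h1, h2, h3⟩ := exists_perm_shift_pair wf hsk hrb hrk
    refine hU.not_lt_of_perm hsr hUq hs₀ hr₀ hyT hzT hyz (τ := τ * Equiv.swap k b) (a := b)
      (b := k) (by simp [h1]) (by simp [h2]) (fun p hpb hpk => ?_) hb hk'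
    simpa [swap_ne hpk hpb] using h3 p hpk hpb
  by_cases hsc : ReflTransGen (Envies w U) s c
  · obtain ⟨τ, h1, h2, h3⟩ := exists_perm_shift_pair wf hrj hsc hsj
    refine hU.not_lt_of_perm hsr hUq hs₀ hr₀ hzT hxT hxz.symm (τ := τ * Equiv.swap j c) (a := j)
      (b := c) (by simp [h2]) (by simp [h1]) (fun p hpj hpc => ?_) hj' hc
    simpa [swap_ne hpj hpc] using h3 p hpj hpc
  obtain ⟨τ, h1, h2, h3⟩ := exists_perm_shift_pair wf ((hreach b).resolve_right hrb)
    ((hreach c).resolve_left hsc) hrb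
  exact hU.not_lt_of_perm hsr hUq hs₀ hr₀ hyT hxT hxy.symm h1 h2 h3 hb hc

end IsMaxTopUp

/-- At most three new items can always be distributed. -/
theorem exists_isTopUp_one_complete {α ι : Type*} [Fintype α] [DecidableEq α] [Nonempty α]
    [DecidableEq ι] (w : α → α → Finset ι → ℝ) (hmono : ∀ p q, Monotone (w p q)) (T : Finset ι)
    (hcard : T.card ≤ 3) :
    ∃ σ U, IsTopUp w 1 T σ U ∧ ∀ t ∈ T, ∃ q, t ∈ U q := by
  classical
  let S : Finset (Equiv.Perm α × (α → Finset ι)) :=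
    (Finset.univ ×ˢ Fintype.piFinset fun _ => T.powerset).filter fun x => IsTopUp w 1 T x.1 x.2
  have hS : ∀ σ U, (σ, U) ∈ S ↔ IsTopUp w 1 T σ U := fun σ U => by
    simp only [S, Finset.mem_filter, Finset.mem_product, Finset.mem_univ, true_and,
      Fintype.mem_piFinset, Finset.mem_powerset, and_iff_right_iff_imp]
    exact fun h => h.subset
  have hne : S.Nonempty := ⟨(1, fun _ => ∅), (hS _ _).mpr ⟨by simp, by simp, by simp, by simp⟩⟩
  obtain ⟨⟨σ, U⟩, hmem, hmax⟩ := S.exists_max_image (fun x => (toLex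
    (∑ p, w p (x.1 p) (x.2 (x.1 p)), ∑ q, (x.2 q).card) : ℝ ×ₗ ℕ)) hne
  rw [hS] at hmem
  have htransfer : ∀ τ V, IsTopUp (fun p q => w p (σ q)) σ⁻¹ T τ V →
      IsTopUp w 1 T (σ * τ) (fun q => V (σ⁻¹ q)) := fun τ V h =>
    ⟨fun q => h.subset _, fun q q' hqq' => h.disjoint _ _ fun h' => hqq' (σ⁻¹.injective h'),
      fun p => by simpa using h.base_le p,
      fun p q u hu => by simpa using h.erase_le p (σ⁻¹ q) u hu⟩
  have hlex : ∀ τ V, IsTopUp (fun p q => w p (σ q)) σ⁻¹ T τ V →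
      (∀ p, w p (σ p) (U (σ p)) ≤ w p (σ (τ p)) (V (τ p))) →
      (∀ p, w p (σ (τ p)) (V (τ p)) ≤ w p (σ p) (U (σ p))) ∧
        ∑ q, (V q).card ≤ ∑ q, (U q).card := fun τ V h hle => by
    have hm := hmax _ ((hS _ _).mpr (htransfer τ V h))
    simp only [Prod.Lex.toLex_le_toLex, Equiv.Perm.mul_apply] at hm
    rw [Equiv.sum_comp σ⁻¹ (fun q => (V q).card)] at hm
    simp only [← Equiv.Perm.mul_apply, inv_mul_cancel_left] at hm
    have hsum : ∑ p, w p (σ p) (U (σ p)) ≤ ∑ p, w p (σ (τ p)) (V (τ p)) :=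
      Finset.sum_le_sum fun p _ => hle p
    rcases hm with hm | ⟨hm, hm'⟩
    · exact absurd hsum (not_le.mpr hm)
    · refine ⟨fun p => ?_, hm'⟩
      exact ((Finset.sum_eq_sum_iff_of_le fun p _ => hle p).mp hm.symm p (Finset.mem_univ p)).ge
  have hU : IsMaxTopUp (fun p q => w p (σ q)) σ⁻¹ T (fun q => U (σ q)) := by
    refine ⟨⟨fun q => hmem.subset _, fun q q' hqq' => hmem.disjoint _ _ (σ.injective.ne hqq'),
      fun p => by simpa using hmem.base_le p, fun p q u hu => hmem.erase_le p _ u hu⟩,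
      fun τ V h hle => (hlex τ V h hle).1, fun τ V h hle => ?_⟩
    rw [Equiv.sum_comp σ (fun q => (U q).card)]
    exact (hlex τ V h hle).2
  obtain ⟨τ, V, hV, hcomp⟩ := hU.exists_isTopUp_complete (fun p q => hmono p _) hcard
  refine ⟨_, _, htransfer τ V hV, fun t ht => ?_⟩
  obtain ⟨q, hq⟩ := hcomp t ht
  exact ⟨σ q, by simpa using hq⟩

/-- `A` is an EFX allocation of the items `P`. -/
structure IsEFXAllocation {α ι : Type*} [DecidableEq ι] (v : α → Finset ι → ℝ) (P : Finset ι)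
    (A : α → Finset ι) : Prop where
  subset : ∀ i, A i ⊆ P
  cover : ∀ g ∈ P, ∃ i, g ∈ A i
  disjoint : ∀ i j, i ≠ j → Disjoint (A i) (A j)
  erase_le : ∀ i j, ∀ g ∈ A j, v i ((A j).erase g) ≤ v i (A i)

/-- For a cancelable valuation, replacing an item by a weakly better one weakly increases the
value of a bundle. -/
theorem le_insert_of_singleton_le {ι : Type*} [DecidableEq ι] {M : Finset ι} {f : Finset ι → ℝ}
    (hcanc : ∀ S T : Finset ι, S ⊆ M → T ⊆ M → ∀ g ∈ M, g ∉ S → g ∉ T →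
      f (insert g S) > f (insert g T) → f S > f T)
    {u g : ι} (hu : u ∈ M) (hg : g ∈ M) (hug : f {u} ≤ f {g}) {R : Finset ι} (hR : R ⊆ M)
    (huR : u ∉ R) (hgR : g ∉ R) : f (insert u R) ≤ f (insert g R) := by
  induction R using Finset.induction_on with
  | empty => simpa using hug
  | insert a R haR ih =>
    simp only [Finset.mem_insert, not_or] at huR hgR
    rw [Finset.insert_subset_iff] at hR
    have ih' := ih hR.2 huR.2 hgR.2
    contrapose! ih'
    rw [Finset.insert_comm u, Finset.insert_comm g] at ih'
    refine hcanc _ _ (Finset.insert_subset hu hR.2) (Finset.insert_subset hg hR.2) a hR.1 ?_ ?_ ih'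
    · simpa [haR] using Ne.symm huR.1
    · simpa [haR] using Ne.symm hgR.1

/-- An EFX allocation of `P` yields one of `P ∪ T` when `T` consists of at most three items that
every agent values at most as much as each item of `P`. -/
theorem IsEFXAllocation.exists_union {α ι : Type*} [Fintype α] [Nonempty α]
    [DecidableEq ι] {M : Finset ι} {v : α → Finset ι → ℝ}
    (hmono : ∀ i, ∀ S T : Finset ι, S ⊆ T → T ⊆ M → v i S ≤ v i T)
    (hcanc : ∀ i, ∀ S T : Finset ι, S ⊆ M → T ⊆ M → ∀ g ∈ M, g ∉ S → g ∉ T →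
      v i (insert g S) > v i (insert g T) → v i S > v i T)
    {P T : Finset ι} (hP : P ⊆ M) (hT : T ⊆ M) (hPT : Disjoint P T) (hcard : T.card ≤ 3)
    (hle : ∀ i, ∀ g ∈ P, ∀ t ∈ T, v i {t} ≤ v i {g}) {B : α → Finset ι}
    (hB : IsEFXAllocation v P B) : ∃ A, IsEFXAllocation v (P ∪ T) A := by
  classical
  obtain ⟨σ, U, hU, hcomp⟩ := exists_isTopUp_one_complete
    (fun p q V => v p (B q ∪ (V ∩ T)))
    (fun p q V W hVW => hmono p _ _
      (Finset.union_subset_union_right (Finset.inter_subset_inter_right hVW))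
      (Finset.union_subset ((hB.subset q).trans hP) (Finset.inter_subset_right.trans hT))) T hcard
  have hinter : ∀ q, U q ∩ T = U q := fun q => Finset.inter_eq_left.mpr (hU.subset q)
  have hinter' : ∀ q u, (U q).erase u ∩ T = (U q).erase u := fun q u =>
    Finset.inter_eq_left.mpr ((Finset.erase_subset _ _).trans (hU.subset q))
  have hbase : ∀ p, v p (B p) ≤ v p (B (σ p) ∪ U (σ p)) := fun p => by
    simpa [hinter] using hU.base_le p
  have herase : ∀ p q, ∀ u ∈ U q,
      v p (B q ∪ (U q).erase u) ≤ v p (B (σ p) ∪ U (σ p)) := fun p q u hu => by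
    simpa only [hinter, hinter'] using hU.erase_le p q u hu
  have hBU : ∀ q q', Disjoint (B q) (U q') := fun q q' =>
    Finset.disjoint_of_subset_left (hB.subset q) (Finset.disjoint_of_subset_right (hU.subset q') hPT)
  have herase' : ∀ q, ∀ u ∈ U q, (B q ∪ U q).erase u = B q ∪ (U q).erase u := fun q u hu => by
    rw [Finset.erase_union_distrib,
      Finset.erase_eq_of_notMem (Finset.disjoint_right.mp (hBU q q) hu)]
  have hsub : ∀ q, B q ∪ U q ⊆ P ∪ T := fun q =>
    Finset.union_subset_union (hB.subset q) (hU.subset q)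
  have hPTM : P ∪ T ⊆ M := Finset.union_subset hP hT
  refine ⟨fun p => B (σ p) ∪ U (σ p), fun p => hsub _, fun g hg => ?_, fun i j hij => ?_,
    fun i j => ?_⟩
  · obtain ⟨q, hq⟩ : ∃ q, g ∈ B q ∪ U q := by
      rcases Finset.mem_union.mp hg with hg | hg
      · obtain ⟨q, hq⟩ := hB.cover g hg
        exact ⟨q, Finset.mem_union_left _ hq⟩
      · obtain ⟨q, hq⟩ := hcomp g hg
        exact ⟨q, Finset.mem_union_right _ hq⟩
    exact ⟨σ⁻¹ q, by simpa using hq⟩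
  · have hne := σ.injective.ne hij
    simp only [Finset.disjoint_union_left, Finset.disjoint_union_right]
    exact ⟨⟨hB.disjoint _ _ hne, (hBU _ _).symm⟩, hBU _ _, hU.disjoint _ _ hne⟩
  · generalize σ j = q
    intro g hg
    rcases (U q).eq_empty_or_nonempty with hempty | ⟨u, hu⟩
    · simp only [hempty, Finset.union_empty] at hg ⊢
      exact (hB.erase_le i q g hg).trans (hbase i)
    rcases Finset.mem_union.mp hg with hgB | hgU
    · refine le_trans ?_ (herase i q u hu)
      rw [← herase' q u hu]
      have huB : u ∈ B q ∪ U q := Finset.mem_union_right _ hu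
      have hne : u ≠ g := by
        rintro rfl
        exact Finset.disjoint_left.mp (hBU q q) hgB hu
      have h := le_insert_of_singleton_le (hcanc i) (hPTM (hsub q huB)) (hPTM (hsub q hg))
        (hle i g (hB.subset q hgB) u (hU.subset q hu))
        (R := ((B q ∪ U q).erase g).erase u)
        (((Finset.erase_subset _ _).trans (Finset.erase_subset _ _)).trans ((hsub q).trans hPTM))
        (Finset.notMem_erase _ _) (fun h => Finset.notMem_erase g _ (Finset.mem_of_mem_erase h))
      rwa [Finset.insert_erase (Finset.mem_erase.mpr ⟨hne, huB⟩), Finset.erase_right_comm,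
        Finset.insert_erase (Finset.mem_erase.mpr ⟨hne.symm, hg⟩)] at h
    · rw [herase' q g hgU]
      exact herase i q g hgU

/-- If `n ≥ 3` agents have monotone, nonnegative, cancelable valuations and share a common
tiered ranking of the items with tiers of size at most 3, then an EFX complete allocation
exists. -/
theorem efx_exists_tiers_of_size_three {ι : Type*} [DecidableEq ι] (n : ℕ) (hn : 3 ≤ n)
    (M : Finset ι) (v : Fin n → Finset ι → ℝ)
    (hmono : ∀ i, ∀ S T : Finset ι, S ⊆ T → T ⊆ M → v i S ≤ v i T)
    (hnonneg : ∀ i, ∀ S : Finset ι, S ⊆ M → 0 ≤ v i S)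
    (hempty : ∀ i, v i ∅ = 0)
    (hcanc : ∀ i, ∀ S T : Finset ι, S ⊆ M → T ⊆ M → ∀ g ∈ M, g ∉ S → g ∉ T →
      v i (insert g S) > v i (insert g T) → v i S > v i T)
    (s : ℕ) (Mt : Fin s → Finset ι)
    (htsub : ∀ j, Mt j ⊆ M)
    (htcover : ∀ g ∈ M, ∃ j, g ∈ Mt j)
    (htdisj : ∀ j k, j ≠ k → Disjoint (Mt j) (Mt k))
    (htsize : ∀ j, (Mt j).card ≤ 3)
    (horder : ∀ i, ∀ j k : Fin s, j < k → ∀ g ∈ Mt j, ∀ h ∈ Mt k, v i {h} ≤ v i {g}) :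
    ∃ A : Fin n → Finset ι,
      (∀ i, A i ⊆ M) ∧
      (∀ g ∈ M, ∃ i, g ∈ A i) ∧
      (∀ i j, i ≠ j → Disjoint (A i) (A j)) ∧
      (∀ i j, ∀ g ∈ A j, v i ((A j).erase g) ≤ v i (A i)) := by
  have : Nonempty (Fin n) := ⟨⟨0, by omega⟩⟩
  let P : ℕ → Finset ι := fun k => (Finset.univ.filter fun j : Fin s => (j : ℕ) < k).biUnion Mt
  have hmem : ∀ k g, g ∈ P k ↔ ∃ j : Fin s, (j : ℕ) < k ∧ g ∈ Mt j := fun k g => by simp [P]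
  have hP : ∀ k, P k ⊆ M := fun k g hg => by
    obtain ⟨j, -, hj⟩ := (hmem k g).mp hg
    exact htsub j hj
  have main : ∀ k ≤ s, ∃ A, IsEFXAllocation v (P k) A := by
    intro k
    induction k with
    | zero => exact fun _ => ⟨fun _ => ∅, by simp, by simp [P], by simp, by simp⟩
    | succ k ih =>
      intro hk
      obtain ⟨B, hB⟩ := ih (Nat.le_of_succ_le hk)
      have hunion : P (k + 1) = P k ∪ Mt ⟨k, hk⟩ := by
        ext g
        simp only [hmem, Finset.mem_union]
        constructor
        · rintro ⟨j, hj, hg⟩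
          rcases Nat.lt_succ_iff_lt_or_eq.mp hj with h | h
          · exact .inl ⟨j, h, hg⟩
          · exact .inr ((Fin.ext h : j = ⟨k, hk⟩) ▸ hg)
        · rintro (⟨j, hj, hg⟩ | hg)
          · exact ⟨j, hj.trans (Nat.lt_succ_self k), hg⟩
          · exact ⟨⟨k, hk⟩, Nat.lt_succ_self k, hg⟩
      rw [hunion]
      refine hB.exists_union hmono hcanc (hP k) (htsub _) ?_ (htsize _) fun i g hg t ht => ?_
      · rw [Finset.disjoint_left]
        intro g hg
        obtain ⟨j, hj, hgj⟩ := (hmem k g).mp hg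
        exact Finset.disjoint_left.mp (htdisj j ⟨k, hk⟩ (Fin.ne_of_lt hj)) hgj
      · obtain ⟨j, hj, hgj⟩ := (hmem k g).mp hg
        exact horder i j ⟨k, hk⟩ hj g hgj t ht
  obtain ⟨A, hA⟩ := main s le_rfl
  refine ⟨A, fun i => (hA.subset i).trans (hP s), fun g hg => ?_, hA.disjoint, hA.erase_le⟩
  obtain ⟨j, hj⟩ := htcover g hg
  exact hA.cover g ((hmem s g).mpr ⟨j, j.2, hj⟩)
end
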